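/- arXiv:2102.10156 — 3 statements merged into one kernel-verified Lean document; each statement's English description precedes it below -/
import Mathlib

section
/- Theorem 2 (regret upper bound for RAI). Assume the regularity conditions with constants D > 0 and p0 > 0, and let B₀ ⊆ {μ ∈ Δ(Ω) : min_ω μ(ω) ≥ p0}. Fix T ≥ 2 and Φ > 0, and for t ∈ [T] set ε_t := min{√(|Ω|/t)·(1 + √(Φ·log T)), 2} (with ε_0 = 2). Run the RAI algorithm: states ω_0,…,ω_{T−1} are i.i.d. from μ* ∈ B₀; at each t, B_t := B₁(γ_t, ε_t) where γ_t is the empirical distribution of the first t states (γ_0 ∈ B₀ arbitrary), σ[h_t] is any maximizer of V(γ_t, σ) over σ ∈ Pers(B_t), and the action a_t is drawn independently from σ[h_t](ω_t, ·). Then for every μ* ∈ B₀, with probability at least 1 − T^{1 − 3Φ√|Ω|/56} − T^{−8Φ|Ω|}, the regret satisfies T·OPT(μ*) − Σ_{t∈[T]} v(ω_t, a_t) ≤ 2·(20/(p0²·D) + 1)·(1 + √(|Ω|·T)·(1 + 2√(Φ·log T))). -/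
/-- A probability distribution on a finite set `Ω`, viewed as a function `Ω → ℝ`. -/
def IsDist {Ω : Type*} [Fintype Ω] (μ : Ω → ℝ) : Prop :=
  (∀ ω, 0 ≤ μ ω) ∧ ∑ ω, μ ω = 1

/-- A signaling mechanism: `σ ω` is a distribution over actions for each state `ω`. -/
def IsMech {Ω A : Type*} [Fintype A] (σ : Ω → A → ℝ) : Prop :=
  ∀ ω, IsDist (σ ω)

/-- The obedience (persuasiveness) constraints for the prior `μ`. -/
def Pers {Ω A : Type*} [Fintype Ω] (u : Ω → A → ℝ) (μ : Ω → ℝ) (σ : Ω → A → ℝ) : Prop :=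
  ∀ a a' : A, 0 ≤ ∑ ω, μ ω * σ ω a * (u ω a - u ω a')

/-- Persuasiveness simultaneously for all priors in a set `B`. -/
def PersOn {Ω A : Type*} [Fintype Ω] (u : Ω → A → ℝ) (B : Set (Ω → ℝ)) (σ : Ω → A → ℝ) : Prop :=
  ∀ μ ∈ B, Pers u μ σ

/-- The sender's expected utility `V(μ, σ)`. -/
noncomputable def Val {Ω A : Type*} [Fintype Ω] [Fintype A]
    (v : Ω → A → ℝ) (μ : Ω → ℝ) (σ : Ω → A → ℝ) : ℝ :=
  ∑ ω, ∑ a, μ ω * σ ω a * v ω a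

/-- The ℓ1 distance between two functions on a finite set. -/
noncomputable def dist1 {Ω : Type*} [Fintype Ω] (μ ν : Ω → ℝ) : ℝ :=
  ∑ ω, |μ ω - ν ω|

/-- The closed ℓ1-ball of radius `ε` around `μ`, inside the simplex `Δ(Ω)`. -/
def ball1 {Ω : Type*} [Fintype Ω] (μ : Ω → ℝ) (ε : ℝ) : Set (Ω → ℝ) :=
  {ν | IsDist ν ∧ dist1 ν μ ≤ ε}

/-- The sender's optimal value `OPT(μ)` over mechanisms persuasive for `μ`. -/
noncomputable def OPT {Ω A : Type*} [Fintype Ω] [Fintype A]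
    (u v : Ω → A → ℝ) (μ : Ω → ℝ) : ℝ :=
  sSup (Val v μ '' {σ | IsMech σ ∧ Pers u μ σ})

/-- The sender's optimal value at `μ` over mechanisms persuasive for all priors in `B`. -/
noncomputable def OPTRobust {Ω A : Type*} [Fintype Ω] [Fintype A]
    (u v : Ω → A → ℝ) (μ : Ω → ℝ) (B : Set (Ω → ℝ)) : ℝ :=
  sSup (Val v μ '' {σ | IsMech σ ∧ PersOn u B σ})

/-- The cost of robust persuasion `GAP(μ, B)`. -/
noncomputable def GAP {Ω A : Type*} [Fintype Ω] [Fintype A]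
    (u v : Ω → A → ℝ) (μ : Ω → ℝ) (B : Set (Ω → ℝ)) : ℝ :=
  OPT u v μ - OPTRobust u v μ B

/-- `P_a`: the set of beliefs for which action `a` is optimal for the receiver. -/
def Popt {Ω A : Type*} [Fintype Ω] [Fintype A] (u : Ω → A → ℝ) (a : A) : Set (Ω → ℝ) :=
  {μ | IsDist μ ∧ ∀ a' : A, ∑ ω, μ ω * u ω a' ≤ ∑ ω, μ ω * u ω a}

/-- The probability of the event `E` when `T` states are drawn i.i.d. from `μ`. -/
noncomputable def prodProb {Ω : Type*} [Fintype Ω] {T : ℕ}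
    (μ : Ω → ℝ) (E : Set (Fin T → Ω)) : ℝ :=
  ∑ x : Fin T → Ω, Set.indicator E (fun y => ∏ t, μ (y t)) x

/-- The expectation of `f` when `T` states are drawn i.i.d. from `μ`. -/
noncomputable def prodExp {Ω : Type*} [Fintype Ω] {T : ℕ}
    (μ : Ω → ℝ) (f : (Fin T → Ω) → ℝ) : ℝ :=
  ∑ x : Fin T → Ω, (∏ t, μ (x t)) * f x

/-- The history `h_t = (ω_0, …, ω_{t−1})` of realized states before time `t`. -/
def hist {Ω : Type*} {T : ℕ} (x : Fin T → Ω) (t : Fin T) : List Ω :=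
  List.ofFn fun i : Fin t.1 => x (Fin.castLE t.isLt.le i)

/-- The joint law of the trajectory `((ω_0, a_0), …, (ω_{T−1}, a_{T−1}))` when states are
drawn i.i.d. from `μ` and, at each time `t`, the action `a_t` is drawn independently from
`alg h_t (ω_t, ·)`, evaluated on the event `E`. -/
noncomputable def jointProb {Ω A : Type*} [Fintype Ω] [Fintype A] {T : ℕ}
    (μ : Ω → ℝ) (alg : List Ω → Ω → A → ℝ) (E : Set (Fin T → Ω × A)) : ℝ :=
  ∑ x : Fin T → Ω × A,
    Set.indicator E
      (fun y => ∏ t, μ (y t).1 * alg (hist (fun s => (y s).1) t) (y t).1 (y t).2) x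

/-- The empirical distribution of a history of states (equal to the default estimate `γ0`
for the empty history). -/
noncomputable def empList {Ω : Type*} [DecidableEq Ω] (γ0 : Ω → ℝ) (h : List Ω) : Ω → ℝ :=
  if h.length = 0 then γ0 else fun ω => (h.count ω : ℝ) / h.length

theorem sum_add_mul_nonneg_of_ball1_subset {Ω A : Type*} [Fintype Ω] [Fintype A]
    {u : Ω → A → ℝ} {a : A} {η : Ω → ℝ} {D : ℝ} (hη : IsDist η)
    (hball : ball1 η D ⊆ Popt u a) {c : ℝ} (hc : 0 ≤ c) {p : Ω → ℝ} (hp : ∀ ω, 0 ≤ p ω)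
    (hle : 2 * ∑ ω, p ω ≤ D * (c + ∑ ω, p ω)) (a' : A) :
    0 ≤ ∑ ω, (c * η ω + p ω) * (u ω a - u ω a') := by
  set P := ∑ ω, p ω with hP
  have hP0 : 0 ≤ P := Finset.sum_nonneg fun ω _ => hp ω
  rcases (add_nonneg hc hP0).eq_or_lt with hs | hs
  · have hc' : c = 0 := by linarith
    have hP' : P = 0 := by linarith
    have hz : ∀ ω, p ω = 0 := fun ω =>
      (Finset.sum_eq_zero_iff_of_nonneg fun ω _ => hp ω).1 hP' ω (Finset.mem_univ ω)
    simp [hc', hz]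
  · have hmem : (fun ω => (c * η ω + p ω) / (c + P)) ∈ ball1 η D := by
      refine ⟨⟨fun ω => div_nonneg (add_nonneg (mul_nonneg hc (hη.1 ω)) (hp ω)) hs.le, ?_⟩, ?_⟩
      · rw [← Finset.sum_div, Finset.sum_add_distrib, ← Finset.mul_sum, hη.2, mul_one,
          div_self hs.ne']
      · have hterm : ∀ ω, |(c * η ω + p ω) / (c + P) - η ω| ≤ (p ω + P * η ω) / (c + P) := by
          intro ω
          have : (c * η ω + p ω) / (c + P) - η ω = (p ω - P * η ω) / (c + P) := by
            field_simp
            ring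
          rw [this, abs_div, abs_of_pos hs]
          gcongr
          have h1 := hp ω
          have h2 := mul_nonneg hP0 (hη.1 ω)
          exact abs_le.2 ⟨by linarith, by linarith⟩
        refine (Finset.sum_le_sum fun ω _ => hterm ω).trans ?_
        rw [← Finset.sum_div, Finset.sum_add_distrib, ← Finset.mul_sum, hη.2, div_le_iff₀ hs]
        linarith
    have h := (hball hmem).2 a'
    have h' : ∑ ω, (c * η ω + p ω) * (u ω a - u ω a')
        = (c + P) * (∑ ω, (c * η ω + p ω) / (c + P) * u ω a
            - ∑ ω, (c * η ω + p ω) / (c + P) * u ω a') := by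
      rw [← Finset.sum_sub_distrib, Finset.mul_sum]
      refine Finset.sum_congr rfl fun ω _ => ?_
      field_simp
    rw [h']
    exact mul_nonneg hs.le (sub_nonneg.2 h)

theorem exists_robust_mech {Ω A : Type*} [Fintype Ω] [Fintype A] [Nonempty A]
    {u v : Ω → A → ℝ} (hv : ∀ ω a, v ω a ∈ Set.Icc (0 : ℝ) 1)
    {D : ℝ} (hD : 0 < D)
    (hreg : ∀ a : A, ∃ η : Ω → ℝ, η ∈ Popt u a ∧ ball1 η D ⊆ Popt u a)
    {p0 : ℝ} (hp0 : 0 < p0) (hp0' : p0 ≤ 1 / 2)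
    {μ : Ω → ℝ} (hμ : IsDist μ) (hμp : ∀ ω, p0 ≤ μ ω)
    {σ : Ω → A → ℝ} (hσ : IsMech σ) (hσP : Pers u μ σ)
    {ε : ℝ} (hε : 0 ≤ ε) (hkε : 20 / (p0 ^ 2 * D) * ε ≤ 1) :
    ∃ σ', IsMech σ' ∧ PersOn u (ball1 μ (2 * ε)) σ' ∧
      Val v μ σ - 20 / (p0 ^ 2 * D) * ε ≤ Val v μ σ' := by
  classical
  choose η hηP hηB using hreg
  have hδ0 : 0 ≤ 20 / (p0 ^ 2 * D) * ε := by positivity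
  rcases lt_or_ge 2 D with hD2 | hD2
  · refine ⟨σ, hσ, fun ν hν a a' => ?_, by linarith⟩
    have hp : ∀ ω, 0 ≤ ν ω * σ ω a := fun ω => mul_nonneg (hν.1.1 ω) ((hσ ω).1 a)
    have := sum_add_mul_nonneg_of_ball1_subset (hηP a).1 (hηB a) le_rfl hp
      (by rw [zero_add]
          exact mul_le_mul_of_nonneg_right hD2.le (Finset.sum_nonneg fun ω _ => hp ω)) a'
    simpa using this
  set δ := 20 / (p0 ^ 2 * D) * ε with hδ
  have hδε : δ * (p0 ^ 2 * D) = 20 * ε := by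
    rw [hδ]; field_simp
  have hμ0 : ∀ ω, 0 < μ ω := fun ω => hp0.trans_le (hμp ω)
  have hbest : ∀ ω, ∃ b, ∀ a', u ω a' ≤ u ω b := fun ω => Finite.exists_max (u ω)
  choose b hb using hbest
  set m : A → ℝ := fun a => ∑ ω, μ ω * σ ω a with hm
  have hm0 : ∀ a, 0 ≤ m a := fun a =>
    Finset.sum_nonneg fun ω _ => mul_nonneg (hμ0 ω).le ((hσ ω).1 a)
  have hm1 : ∑ a, m a = 1 := by
    simp only [hm]
    rw [Finset.sum_comm]
    simp only [← Finset.mul_sum, (hσ _).2, mul_one, hμ.2]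
  set ρ : Ω → ℝ := fun ω => ∑ a, m a * η a ω with hρ
  have hη1 : ∀ a ω, η a ω ≤ 1 := fun a ω => by
    rw [← (hηP a).1.2]
    exact Finset.single_le_sum (fun i _ => (hηP a).1.1 i) (Finset.mem_univ ω)
  have hρ1 : ∀ ω, ρ ω ≤ 1 := fun ω => by
    rw [← hm1]
    exact Finset.sum_le_sum fun a _ => mul_le_of_le_one_right (hm0 a) (hη1 a ω)
  set τ : Ω → A → ℝ := fun ω a => (1 - δ) * σ ω a + δ * p0 * m a * η a ω / μ ω with hτ
  have hτ0 : ∀ ω a, 0 ≤ τ ω a := fun ω a => by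
    have h1 := hm0 a
    have h2 := (hηP a).1.1 ω
    have h3 := hμ0 ω
    have h4 := (hσ ω).1 a
    have h5 : 0 ≤ 1 - δ := by linarith
    simp only [hτ]
    positivity
  set l : Ω → ℝ := fun ω => δ - δ * p0 * ρ ω / μ ω with hl
  have hl0 : ∀ ω, 0 ≤ l ω := fun ω => by
    simp only [hl]
    rw [sub_nonneg, div_le_iff₀ (hμ0 ω), mul_assoc]
    refine mul_le_mul_of_nonneg_left ?_ hδ0
    nlinarith [hρ1 ω, hμp ω]
  have hσ'0 : ∀ ω a, 0 ≤ l ω * if b ω = a then 1 else 0 := fun ω a =>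
    mul_nonneg (hl0 ω) (by split_ifs <;> norm_num)
  refine ⟨fun ω a => τ ω a + l ω * if b ω = a then 1 else 0, fun ω => ⟨fun a => ?_, ?_⟩,
    fun ν hν a a' => ?_, ?_⟩
  · exact add_nonneg (hτ0 ω a) (hσ'0 ω a)
  · have : ∑ a, δ * p0 * m a * η a ω / μ ω = δ * p0 * ρ ω / μ ω := by
      rw [← Finset.sum_div, hρ, Finset.mul_sum]
      simp only [mul_assoc]
    simp only [hτ, hl, Finset.sum_add_distrib, this, ← Finset.mul_sum, (hσ ω).2]
    simp
  · set r := 2 * ε / p0 with hr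
    have hrp : r * p0 = 2 * ε := by rw [hr]; field_simp
    have hr0 : 0 ≤ r := by positivity
    have hr1 : r ≤ 1 / 10 := by
      have : 20 * ε ≤ p0 ^ 2 * D := by
        rw [← hδε]; exact mul_le_of_le_one_left (by positivity) hkε
      rw [hr, div_le_iff₀ hp0]
      nlinarith [mul_le_mul_of_nonneg_left hD2 (sq_nonneg p0)]
    have hμτ : ∀ ω, μ ω * τ ω a = (1 - δ) * (μ ω * σ ω a) + δ * p0 * m a * η a ω := fun ω => by
      have := (hμ0 ω).ne'
      simp only [hτ]
      field_simp
    have hsumτ : ∑ ω, μ ω * τ ω a ≤ m a := by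
      simp only [hμτ, Finset.sum_add_distrib, ← Finset.mul_sum, (hηP a).1.2]
      change (1 - δ) * m a + _ ≤ _
      nlinarith [mul_nonneg hδ0 (hm0 a)]
    have hτm : ∀ ω, τ ω a ≤ m a / p0 := fun ω => by
      rw [le_div_iff₀ hp0]
      calc τ ω a * p0 ≤ μ ω * τ ω a := by nlinarith [hτ0 ω a, hμp ω]
        _ ≤ ∑ ω, μ ω * τ ω a := Finset.single_le_sum
            (f := fun ω => μ ω * τ ω a)
            (fun ω _ => mul_nonneg (hμ0 ω).le (hτ0 ω a)) (Finset.mem_univ ω)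
        _ ≤ m a := hsumτ
    have hνμ : ∀ ω, |ν ω - μ ω| ≤ 2 * ε := fun ω =>
      (Finset.single_le_sum (f := fun ω => |ν ω - μ ω|)
        (fun ω _ => abs_nonneg _) (Finset.mem_univ ω)).trans hν.2
    have hp : ∀ ω, 0 ≤ (ν ω - (1 - r) * μ ω) * τ ω a := fun ω => by
      refine mul_nonneg ?_ (hτ0 ω a)
      have := (abs_le.1 (hνμ ω)).1
      nlinarith [hμp ω]
    have hps : ∑ ω, (ν ω - (1 - r) * μ ω) * τ ω a ≤ 4 * ε * (m a / p0) := by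
      have h1 : ∑ ω, (ν ω - μ ω) * τ ω a ≤ 2 * ε * (m a / p0) :=
        calc ∑ ω, (ν ω - μ ω) * τ ω a ≤ ∑ ω, |ν ω - μ ω| * (m a / p0) :=
              Finset.sum_le_sum fun ω _ => mul_le_mul (le_abs_self _) (hτm ω) (hτ0 ω a)
                (abs_nonneg _)
          _ = dist1 ν μ * (m a / p0) := by rw [← Finset.sum_mul]; rfl
          _ ≤ _ := mul_le_mul_of_nonneg_right hν.2 (div_nonneg (hm0 a) hp0.le)
      have h2 : ∑ ω, (ν ω - (1 - r) * μ ω) * τ ω a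
          = ∑ ω, (ν ω - μ ω) * τ ω a + r * ∑ ω, μ ω * τ ω a := by
        rw [Finset.mul_sum, ← Finset.sum_add_distrib]
        exact Finset.sum_congr rfl fun ω _ => by ring
      have h3 : r * ∑ ω, μ ω * τ ω a ≤ r * m a := mul_le_mul_of_nonneg_left hsumτ hr0
      have h4 : r * m a = 2 * ε * (m a / p0) := by rw [hr]; ring
      linarith
    have hcone := sum_add_mul_nonneg_of_ball1_subset (hηP a).1 (hηB a)
      (c := (1 - r) * (δ * p0 * m a))
      (mul_nonneg (by linarith) (mul_nonneg (by positivity) (hm0 a))) hp (by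
        have hP0 := Finset.sum_nonneg fun ω (_ : ω ∈ Finset.univ) => hp ω
        have h1 : D * (δ * p0 * m a) = 20 * ε * (m a / p0) := by
          rw [← hδε]; field_simp
        have h2 : 0 ≤ 20 * ε * (m a / p0) :=
          mul_nonneg (by positivity) (div_nonneg (hm0 a) hp0.le)
        nlinarith [mul_nonneg hD.le hP0]) a'
    have hsplit : ∑ ω, ν ω * (τ ω a + l ω * if b ω = a then 1 else 0) * (u ω a - u ω a')
        = (1 - r) * (1 - δ) * ∑ ω, μ ω * σ ω a * (u ω a - u ω a')
          + ∑ ω, ((1 - r) * (δ * p0 * m a) * η a ω + (ν ω - (1 - r) * μ ω) * τ ω a)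
              * (u ω a - u ω a')
          + ∑ ω, ν ω * (l ω * if b ω = a then 1 else 0) * (u ω a - u ω a') := by
      rw [Finset.mul_sum, ← Finset.sum_add_distrib, ← Finset.sum_add_distrib]
      refine Finset.sum_congr rfl fun ω _ => ?_
      linear_combination (1 - r) * (u ω a - u ω a') * hμτ ω
    rw [hsplit]
    refine add_nonneg (add_nonneg (mul_nonneg (mul_nonneg (by linarith) (by linarith))
      (hσP a a')) hcone) (Finset.sum_nonneg fun ω _ => ?_)
    by_cases hba : b ω = a
    · exact mul_nonneg (mul_nonneg (hν.1.1 ω) (hσ'0 ω a)) (sub_nonneg.2 (hba ▸ hb ω a'))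
    · simp [hba]
  · have h1 : (1 - δ) * Val v μ σ
        ≤ Val v μ fun ω a => τ ω a + l ω * if b ω = a then 1 else 0 := by
      simp only [Val, Finset.mul_sum]
      refine Finset.sum_le_sum fun ω _ => Finset.sum_le_sum fun a _ => ?_
      rw [← mul_assoc]
      refine mul_le_mul_of_nonneg_right ?_ (hv ω a).1
      have hη0 : 0 ≤ δ * p0 * m a * η a ω / μ ω :=
        div_nonneg (mul_nonneg (mul_nonneg (by positivity) (hm0 a)) ((hηP a).1.1 ω)) (hμ0 ω).le
      have h3 := mul_nonneg (hμ0 ω).le (add_nonneg hη0 (hσ'0 ω a))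
      simp only [hτ]
      linarith
    have h2 : Val v μ σ ≤ 1 := by
      calc Val v μ σ ≤ ∑ ω, ∑ a, μ ω * σ ω a := Finset.sum_le_sum fun ω _ =>
            Finset.sum_le_sum fun a _ => mul_le_of_le_one_right
              (mul_nonneg (hμ0 ω).le ((hσ ω).1 a)) (hv ω a).2
        _ = 1 := by simp only [← Finset.mul_sum, (hσ _).2, mul_one, hμ.2]
    nlinarith

theorem val_nonneg {Ω A : Type*} [Fintype Ω] [Fintype A] {v : Ω → A → ℝ}
    (hv : ∀ ω a, v ω a ∈ Set.Icc (0 : ℝ) 1) {μ : Ω → ℝ} (hμ : IsDist μ)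
    {σ : Ω → A → ℝ} (hσ : IsMech σ) : 0 ≤ Val v μ σ :=
  Finset.sum_nonneg fun ω _ => Finset.sum_nonneg fun a _ =>
    mul_nonneg (mul_nonneg (hμ.1 ω) ((hσ ω).1 a)) (hv ω a).1

theorem val_le_one {Ω A : Type*} [Fintype Ω] [Fintype A] {v : Ω → A → ℝ}
    (hv : ∀ ω a, v ω a ∈ Set.Icc (0 : ℝ) 1) {μ : Ω → ℝ} (hμ : IsDist μ)
    {σ : Ω → A → ℝ} (hσ : IsMech σ) : Val v μ σ ≤ 1 := by
  calc Val v μ σ ≤ ∑ ω, ∑ a, μ ω * σ ω a := Finset.sum_le_sum fun ω _ =>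
        Finset.sum_le_sum fun a _ => mul_le_of_le_one_right
          (mul_nonneg (hμ.1 ω) ((hσ ω).1 a)) (hv ω a).2
    _ = 1 := by simp only [← Finset.mul_sum, (hσ _).2, mul_one, hμ.2]

theorem val_le_val_add_dist1 {Ω A : Type*} [Fintype Ω] [Fintype A] {v : Ω → A → ℝ}
    (hv : ∀ ω a, v ω a ∈ Set.Icc (0 : ℝ) 1) {μ ν : Ω → ℝ} (hμ : IsDist μ) (hν : IsDist ν)
    {σ : Ω → A → ℝ} (hσ : IsMech σ) : Val v μ σ ≤ Val v ν σ + dist1 μ ν / 2 := by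
  set w : Ω → ℝ := fun ω => ∑ a, σ ω a * v ω a with hw
  have hw0 : ∀ ω, 0 ≤ w ω := fun ω =>
    Finset.sum_nonneg fun a _ => mul_nonneg ((hσ ω).1 a) (hv ω a).1
  have hw1 : ∀ ω, w ω ≤ 1 := fun ω => by
    rw [← (hσ ω).2]
    exact Finset.sum_le_sum fun a _ => mul_le_of_le_one_right ((hσ ω).1 a) (hv ω a).2
  have hVal : ∀ μ : Ω → ℝ, Val v μ σ = ∑ ω, μ ω * w ω := fun μ => by
    simp only [Val, hw, Finset.mul_sum, mul_assoc]
  have h : Val v μ σ - Val v ν σ = ∑ ω, (μ ω - ν ω) * (w ω - 1 / 2) := by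
    simp only [hVal, mul_sub, sub_mul, Finset.sum_sub_distrib, ← Finset.sum_mul, hμ.2, hν.2]
    ring
  have h' : ∑ ω, (μ ω - ν ω) * (w ω - 1 / 2) ≤ ∑ ω, |μ ω - ν ω| * (1 / 2) :=
    Finset.sum_le_sum fun ω _ => by
      refine (le_abs_self _).trans ?_
      rw [abs_mul]
      refine mul_le_mul_of_nonneg_left ?_ (abs_nonneg _)
      exact abs_le.2 ⟨by linarith [hw0 ω], by linarith [hw1 ω]⟩
  rw [← Finset.sum_mul] at h'
  change _ ≤ dist1 μ ν * _ at h'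
  linarith

theorem dist1_comm {Ω : Type*} [Fintype Ω] (μ ν : Ω → ℝ) : dist1 μ ν = dist1 ν μ :=
  Finset.sum_congr rfl fun _ _ => abs_sub_comm _ _

theorem dist1_triangle {Ω : Type*} [Fintype Ω] (μ ν ρ : Ω → ℝ) :
    dist1 μ ρ ≤ dist1 μ ν + dist1 ν ρ := by
  rw [dist1, dist1, dist1, ← Finset.sum_add_distrib]
  exact Finset.sum_le_sum fun ω _ => abs_sub_le _ _ _

theorem dist1_le_two {Ω : Type*} [Fintype Ω] {μ ν : Ω → ℝ} (hμ : IsDist μ) (hν : IsDist ν) :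
    dist1 μ ν ≤ 2 := by
  calc dist1 μ ν ≤ ∑ ω, (μ ω + ν ω) := Finset.sum_le_sum fun ω _ =>
        abs_le.2 ⟨by linarith [hμ.1 ω, hν.1 ω], by linarith [hμ.1 ω, hν.1 ω]⟩
    _ = 2 := by rw [Finset.sum_add_distrib, hμ.2, hν.2]; norm_num

theorem opt_sub_val_le {Ω A : Type*} [Fintype Ω] [Fintype A] [Nonempty A]
    {u v : Ω → A → ℝ} (hv : ∀ ω a, v ω a ∈ Set.Icc (0 : ℝ) 1)
    {D : ℝ} (hD : 0 < D)
    (hreg : ∀ a : A, ∃ η : Ω → ℝ, η ∈ Popt u a ∧ ball1 η D ⊆ Popt u a)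
    {p0 : ℝ} (hp0 : 0 < p0) (hp0' : p0 ≤ 1 / 2)
    {μ : Ω → ℝ} (hμ : IsDist μ) (hμp : ∀ ω, p0 ≤ μ ω)
    {γ : Ω → ℝ} (hγ : IsDist γ) {ε : ℝ} (hε : 0 ≤ ε) (hdist : dist1 γ μ ≤ ε)
    {τ : Ω → A → ℝ} (hτ : IsMech τ)
    (hopt : ∀ σ, IsMech σ → PersOn u (ball1 γ ε) σ → Val v γ σ ≤ Val v γ τ) :
    OPT u v μ - Val v μ τ ≤ (20 / (p0 ^ 2 * D) + 1) * ε := by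
  have hτ0 := val_nonneg hv hμ hτ
  have hkε0 : 0 ≤ 20 / (p0 ^ 2 * D) * ε := by positivity
  rw [sub_le_iff_le_add, add_mul, one_mul]
  refine Real.sSup_le ?_ (by linarith)
  rintro _ ⟨σ, ⟨hσ, hσP⟩, rfl⟩
  rcases le_or_gt (20 / (p0 ^ 2 * D) * ε) 1 with hkε | hkε
  · obtain ⟨σ', hσ', hP', hV'⟩ := exists_robust_mech hv hD hreg hp0 hp0' hμ hμp hσ hσP hε hkε
    have h1 := hopt σ' hσ' fun ν hν =>
      hP' ν ⟨hν.1, (dist1_triangle ν γ μ).trans (by linarith [hν.2])⟩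
    have h2 := val_le_val_add_dist1 hv hμ hγ hσ'
    have h3 := val_le_val_add_dist1 hv hγ hμ hτ
    rw [dist1_comm] at h2
    linarith
  · linarith [val_le_one hv hμ hσ]

theorem sum_mul_exp_le {ι : Type*} [Fintype ι] {w : ι → ℝ} (hw : IsDist w) {f : ι → ℝ} {c : ℝ}
    (hf : ∀ i j, f i - f j ≤ c) :
    ∑ i, w i * Real.exp (f i) ≤ Real.exp (∑ i, w i * f i + c ^ 2 / 8) := by
  classical
  have hne : Nonempty ι := by
    by_contra h
    rw [not_nonempty_iff] at h
    simpa using hw.2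
  obtain ⟨i₀, hi₀⟩ := Finite.exists_min f
  let _ : MeasurableSpace ι := ⊤
  have hsum : ∑ i, ENNReal.ofReal (w i) = 1 := by
    rw [← ENNReal.ofReal_sum_of_nonneg fun i _ => hw.1 i, hw.2, ENNReal.ofReal_one]
  set p : PMF ι := PMF.ofFintype _ hsum
  have hint : ∀ g : ι → ℝ, ∫ i, g i ∂p.toMeasure = ∑ i, w i * g i := fun g => by
    rw [PMF.integral_eq_sum]
    exact Finset.sum_congr rfl fun i _ => by simp [p, ENNReal.toReal_ofReal (hw.1 i)]
  have hc : 0 ≤ c := by simpa using hf i₀ i₀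
  have h := (ProbabilityTheory.hasSubgaussianMGF_of_mem_Icc (μ := p.toMeasure) (X := f)
    (a := f i₀) (b := f i₀ + c) measurable_from_top.aemeasurable
    (Filter.Eventually.of_forall fun i => ⟨hi₀ i, by linarith [hf i i₀]⟩)).mgf_le 1
  rw [ProbabilityTheory.mgf, hint, hint] at h
  have hexp : ∑ i, w i * Real.exp (f i)
      = Real.exp (∑ i, w i * f i) * ∑ i, w i * Real.exp (1 * (f i - ∑ i, w i * f i)) := by
    rw [Finset.mul_sum]
    refine Finset.sum_congr rfl fun i _ => ?_
    rw [mul_left_comm, ← Real.exp_add]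
    ring_nf
  rw [hexp, Real.exp_add]
  refine mul_le_mul_of_nonneg_left (h.trans_eq ?_) (Real.exp_nonneg _)
  congr 1
  push_cast
  rw [Real.norm_eq_abs, div_pow, sq_abs]
  ring

theorem sum_pi_fin_succ {α : Type*} [Fintype α] {n : ℕ} (f : (Fin (n + 1) → α) → ℝ) :
    ∑ x, f x = ∑ a, ∑ y : Fin n → α, f (Fin.cons a y) := by
  rw [← Fintype.sum_prod_type', ← (Fin.consEquiv fun _ => α).sum_comp]
  rfl

theorem isDist_prod {Ω : Type*} [Fintype Ω] {μ : Ω → ℝ} (hμ : IsDist μ) (n : ℕ) :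
    IsDist fun x : Fin n → Ω => ∏ i, μ (x i) := by
  refine ⟨fun x => Finset.prod_nonneg fun i _ => hμ.1 _, ?_⟩
  induction n with
  | zero => simp
  | succ n ih =>
    rw [sum_pi_fin_succ]
    simp only [Fin.prod_univ_succ, Fin.cons_zero, Fin.cons_succ, ← Finset.mul_sum, ih, mul_one,
      hμ.2]

theorem sum_prod_mul_exp_le {Ω : Type*} [Fintype Ω] {μ : Ω → ℝ} (hμ : IsDist μ) {n : ℕ}
    {F : (Fin n → Ω) → ℝ} {c : Fin n → ℝ}
    (hF : ∀ x i a, F (Function.update x i a) - F x ≤ c i) :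
    ∑ x : Fin n → Ω, (∏ i, μ (x i)) * Real.exp (F x)
      ≤ Real.exp (∑ x : Fin n → Ω, (∏ i, μ (x i)) * F x + (∑ i, c i ^ 2) / 8) := by
  induction n with
  | zero => simp
  | succ n ih =>
    have hG : ∀ (x : Fin n → Ω) i a,
        ∑ b, μ b * F (Fin.cons b (Function.update x i a)) - ∑ b, μ b * F (Fin.cons b x)
          ≤ c i.succ := by
      intro x i a
      rw [← Finset.sum_sub_distrib]
      calc _ ≤ ∑ b, μ b * c i.succ := Finset.sum_le_sum fun b _ => by
            rw [← mul_sub, Fin.cons_update]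
            exact mul_le_mul_of_nonneg_left (hF _ _ _) (hμ.1 b)
        _ = _ := by rw [← Finset.sum_mul, hμ.2, one_mul]
    have hstep : ∀ y : Fin n → Ω, ∑ b, μ b * Real.exp (F (Fin.cons b y))
        ≤ Real.exp (∑ b, μ b * F (Fin.cons b y)) * Real.exp (c 0 ^ 2 / 8) := fun y => by
      rw [← Real.exp_add]
      refine sum_mul_exp_le hμ fun i j => ?_
      simpa using hF (Fin.cons j y : Fin (n + 1) → Ω) 0 i
    rw [sum_pi_fin_succ, sum_pi_fin_succ, Finset.sum_comm]
    simp only [Fin.prod_univ_succ, Fin.cons_zero, Fin.cons_succ]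
    calc _ = ∑ y : Fin n → Ω, (∏ i, μ (y i)) * ∑ b, μ b * Real.exp (F (Fin.cons b y)) := by
          refine Finset.sum_congr rfl fun y _ => ?_
          rw [Finset.mul_sum]
          exact Finset.sum_congr rfl fun b _ => by ring
      _ ≤ ∑ y : Fin n → Ω, (∏ i, μ (y i)) *
            (Real.exp (∑ b, μ b * F (Fin.cons b y)) * Real.exp (c 0 ^ 2 / 8)) :=
          Finset.sum_le_sum fun y _ =>
            mul_le_mul_of_nonneg_left (hstep y) ((isDist_prod hμ n).1 y)
      _ ≤ Real.exp (∑ y : Fin n → Ω, (∏ i, μ (y i)) * ∑ b, μ b * F (Fin.cons b y)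
            + (∑ i : Fin n, c i.succ ^ 2) / 8) * Real.exp (c 0 ^ 2 / 8) := by
          simp only [← mul_assoc]
          rw [← Finset.sum_mul]
          exact mul_le_mul_of_nonneg_right (ih hG) (Real.exp_nonneg _)
      _ = _ := by
          rw [← Real.exp_add]
          congr 1
          rw [Fin.sum_univ_succ, Finset.sum_comm]
          simp only [Finset.mul_sum]
          have : ∀ (y : Fin n → Ω) b, (∏ i, μ (y i)) * (μ b * F (Fin.cons b y))
            = μ b * (∏ i, μ (y i)) * F (Fin.cons b y) := fun y b => by ring
          simp only [this]
          rw [Finset.sum_comm]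
          ring

theorem sum_prod_mul_sq_sum {Ω : Type*} [Fintype Ω] {μ : Ω → ℝ} (hμ : IsDist μ) {n : ℕ}
    (φ : Fin n → Ω → ℝ) (hφ : ∀ i, ∑ ω, μ ω * φ i ω = 0) :
    ∑ x : Fin n → Ω, (∏ i, μ (x i)) * (∑ i, φ i (x i)) = 0 ∧
    ∑ x : Fin n → Ω, (∏ i, μ (x i)) * (∑ i, φ i (x i)) ^ 2 = ∑ i, ∑ ω, μ ω * φ i ω ^ 2 := by
  induction n with
  | zero => simp
  | succ n ih =>
    obtain ⟨ih1, ih2⟩ := ih (fun i => φ i.succ) fun i => hφ i.succ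
    have hone := (isDist_prod hμ n).2
    rw [sum_pi_fin_succ, sum_pi_fin_succ, Fin.sum_univ_succ]
    simp only [Fin.prod_univ_succ, Fin.sum_univ_succ, Fin.cons_zero, Fin.cons_succ]
    constructor
    · have : ∀ b, ∑ y : Fin n → Ω, μ b * (∏ i, μ (y i)) * (φ 0 b + ∑ i, φ i.succ (y i))
          = μ b * φ 0 b := fun b => by
        have : ∀ y : Fin n → Ω, μ b * (∏ i, μ (y i)) * (φ 0 b + ∑ i, φ i.succ (y i))
          = μ b * φ 0 b * (∏ i, μ (y i)) + μ b * ((∏ i, μ (y i)) * ∑ i, φ i.succ (y i)) :=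
          fun y => by ring
        simp only [this, Finset.sum_add_distrib, ← Finset.mul_sum, hone, ih1]
        ring
      simp only [this, hφ]
    · have : ∀ b, ∑ y : Fin n → Ω, μ b * (∏ i, μ (y i)) * (φ 0 b + ∑ i, φ i.succ (y i)) ^ 2
          = μ b * φ 0 b ^ 2 + μ b * ∑ i : Fin n, ∑ ω, μ ω * φ i.succ ω ^ 2 := fun b => by
        have : ∀ y : Fin n → Ω, μ b * (∏ i, μ (y i)) * (φ 0 b + ∑ i, φ i.succ (y i)) ^ 2
          = μ b * φ 0 b ^ 2 * (∏ i, μ (y i))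
            + 2 * μ b * φ 0 b * ((∏ i, μ (y i)) * ∑ i, φ i.succ (y i))
            + μ b * ((∏ i, μ (y i)) * (∑ i, φ i.succ (y i)) ^ 2) :=
          fun y => by ring
        simp only [this, Finset.sum_add_distrib, ← Finset.mul_sum, hone, ih1, ih2]
        ring
      simp only [this, Finset.sum_add_distrib, ← Finset.sum_mul, hμ.2, one_mul]

theorem sq_sum_mul_le {ι : Type*} [Fintype ι] {w : ι → ℝ} (hw : IsDist w) (f : ι → ℝ) :
    (∑ i, w i * f i) ^ 2 ≤ ∑ i, w i * f i ^ 2 := by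
  set m := ∑ i, w i * f i with hm
  have h : 0 ≤ ∑ i, w i * (f i - m) ^ 2 :=
    Finset.sum_nonneg fun i _ => mul_nonneg (hw.1 i) (sq_nonneg _)
  have hexp : ∀ i, w i * (f i - m) ^ 2 = w i * f i ^ 2 - 2 * m * (w i * f i) + m ^ 2 * w i :=
    fun i => by ring
  simp only [hexp, Finset.sum_add_distrib, Finset.sum_sub_distrib, ← Finset.mul_sum, hw.2,
    ← hm] at h
  nlinarith

/-- The `ℓ1` norm of the centered count vector of the first `t` coordinates of `x`. -/
noncomputable def countDev {Ω : Type*} [Fintype Ω] [DecidableEq Ω] {n : ℕ} (μ : Ω → ℝ) (t : ℕ)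
    (x : Fin n → Ω) : ℝ :=
  ∑ ω, |∑ i : Fin n, (if i.1 < t then (1 : ℝ) else 0) * ((if x i = ω then 1 else 0) - μ ω)|

theorem sum_ite_val_lt {n t : ℕ} (ht : t ≤ n) :
    ∑ i : Fin n, (if i.1 < t then (1 : ℝ) else 0) = t := by
  rw [Finset.sum_boole, Fin.card_filter_val_lt, min_eq_right ht]

theorem countDev_update_sub_le {Ω : Type*} [Fintype Ω] [DecidableEq Ω] {n : ℕ} (μ : Ω → ℝ)
    (t : ℕ) (x : Fin n → Ω) (i : Fin n) (a : Ω) :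
    countDev μ t (Function.update x i a) - countDev μ t x
      ≤ 2 * (if i.1 < t then (1 : ℝ) else 0) := by
  rw [countDev, countDev, ← Finset.sum_sub_distrib]
  have hb : (0 : ℝ) ≤ if i.1 < t then (1 : ℝ) else 0 := by split_ifs <;> norm_num
  have hterm : ∀ ω,
      |∑ j : Fin n, (if j.1 < t then (1 : ℝ) else 0)
          * ((if Function.update x i a j = ω then 1 else 0) - μ ω)|
        - |∑ j : Fin n, (if j.1 < t then (1 : ℝ) else 0) * ((if x j = ω then 1 else 0) - μ ω)|
      ≤ (if i.1 < t then (1 : ℝ) else 0)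
          * ((if a = ω then 1 else 0) + (if x i = ω then 1 else 0)) := by
    intro ω
    refine (abs_sub_abs_le_abs_sub _ _).trans ?_
    rw [← Finset.sum_sub_distrib, Finset.sum_eq_single i]
    · rw [← mul_sub, abs_mul, abs_of_nonneg hb, Function.update_self]
      refine mul_le_mul_of_nonneg_left ?_ hb
      split_ifs <;> exact abs_le.2 ⟨by linarith, by linarith⟩
    · intro j _ hj
      rw [Function.update_of_ne hj, sub_self]
    · simp
  refine (Finset.sum_le_sum fun ω _ => hterm ω).trans_eq ?_
  rw [← Finset.mul_sum, Finset.sum_add_distrib]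
  simp only [Finset.sum_ite_eq, Finset.mem_univ, if_true]
  ring

theorem sum_prod_mul_countDev_le {Ω : Type*} [Fintype Ω] [DecidableEq Ω] {μ : Ω → ℝ}
    (hμ : IsDist μ) {n t : ℕ} (ht : t ≤ n) :
    ∑ x : Fin n → Ω, (∏ i, μ (x i)) * countDev μ t x ≤ √(Fintype.card Ω * t) := by
  refine Real.le_sqrt_of_sq_le ((sq_sum_mul_le (isDist_prod hμ n) _).trans ?_)
  have hvar : ∀ ω, ∑ x : Fin n → Ω, (∏ i, μ (x i)) *
      (∑ i : Fin n, (if i.1 < t then (1 : ℝ) else 0) * ((if x i = ω then 1 else 0) - μ ω)) ^ 2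
      ≤ t * μ ω := by
    intro ω
    rw [(sum_prod_mul_sq_sum hμ
      (fun i ω' => (if i.1 < t then (1 : ℝ) else 0) * ((if ω' = ω then 1 else 0) - μ ω))
      fun i => ?_).2]
    · rw [← sum_ite_val_lt ht, Finset.sum_mul]
      refine Finset.sum_le_sum fun i _ => ?_
      split_ifs
      · have : ∀ ω', μ ω' * (1 * ((if ω' = ω then 1 else 0) - μ ω)) ^ 2
            = μ ω' * (if ω' = ω then 1 else 0) * (1 - 2 * μ ω) + μ ω' * μ ω ^ 2 := fun ω' => by
          split_ifs <;> ring
        simp only [this, Finset.sum_add_distrib, ← Finset.sum_mul, hμ.2]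
        simp only [mul_ite, mul_one, mul_zero, Finset.sum_ite_eq', Finset.mem_univ, if_true]
        nlinarith [sq_nonneg (μ ω)]
      · simp
    · have : ∀ ω', μ ω' * ((if i.1 < t then (1 : ℝ) else 0) * ((if ω' = ω then 1 else 0) - μ ω))
          = (if i.1 < t then (1 : ℝ) else 0) * (μ ω' * (if ω' = ω then 1 else 0) - μ ω' * μ ω) :=
        fun ω' => by ring
      simp only [this, ← Finset.mul_sum, Finset.sum_sub_distrib, ← Finset.sum_mul, hμ.2]
      simp
  calc _ ≤ ∑ x : Fin n → Ω, (∏ i, μ (x i)) * (Fintype.card Ω * ∑ ω,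
          (∑ i : Fin n, (if i.1 < t then (1 : ℝ) else 0)
            * ((if x i = ω then 1 else 0) - μ ω)) ^ 2) := by
        refine Finset.sum_le_sum fun x _ =>
          mul_le_mul_of_nonneg_left ?_ ((isDist_prod hμ n).1 x)
        refine sq_sum_le_card_mul_sum_sq.trans_eq ?_
        simp only [sq_abs, Finset.card_univ]
    _ = Fintype.card Ω * ∑ ω, ∑ x : Fin n → Ω, (∏ i, μ (x i)) *
          (∑ i : Fin n, (if i.1 < t then (1 : ℝ) else 0)
            * ((if x i = ω then 1 else 0) - μ ω)) ^ 2 := by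
        rw [Finset.sum_comm, Finset.mul_sum]
        refine Finset.sum_congr rfl fun x _ => ?_
        rw [← Finset.mul_sum]
        ring
    _ ≤ Fintype.card Ω * ∑ ω, t * μ ω :=
        mul_le_mul_of_nonneg_left (Finset.sum_le_sum fun ω _ => hvar ω) (Nat.cast_nonneg _)
    _ = _ := by rw [← Finset.mul_sum, hμ.2, mul_one]

theorem sum_prod_mul_exp_countDev_le {Ω : Type*} [Fintype Ω] [DecidableEq Ω] {μ : Ω → ℝ}
    (hμ : IsDist μ) {n t : ℕ} (ht : t ≤ n) {r : ℝ} (hr : 0 ≤ r) :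
    ∑ x : Fin n → Ω, (∏ i, μ (x i)) * Real.exp (r * countDev μ t x)
      ≤ Real.exp (r * √(Fintype.card Ω * t) + r ^ 2 * t / 2) := by
  refine (sum_prod_mul_exp_le hμ
    (c := fun i => r * (2 * (if i.1 < t then (1 : ℝ) else 0))) fun x i a => ?_).trans ?_
  · rw [← mul_sub]
    exact mul_le_mul_of_nonneg_left (countDev_update_sub_le μ t x i a) hr
  · have h1 : ∑ i : Fin n, (r * (2 * (if i.1 < t then (1 : ℝ) else 0))) ^ 2 = 4 * r ^ 2 * t := by
      rw [← sum_ite_val_lt ht, Finset.mul_sum]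
      refine Finset.sum_congr rfl fun i _ => ?_
      split_ifs <;> ring
    have h2 : ∑ x : Fin n → Ω, (∏ i, μ (x i)) * (r * countDev μ t x)
        = r * ∑ x : Fin n → Ω, (∏ i, μ (x i)) * countDev μ t x := by
      rw [Finset.mul_sum]
      exact Finset.sum_congr rfl fun x _ => by ring
    rw [h1, h2]
    refine Real.exp_le_exp.2 ?_
    have := mul_le_mul_of_nonneg_left (sum_prod_mul_countDev_le hμ ht) hr
    linarith

/-- The weight of a trajectory under `jointProb`. -/
noncomputable def jointWeight {Ω A : Type*} {n : ℕ} (μ : Ω → ℝ) (alg : List Ω → Ω → A → ℝ)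
    (y : Fin n → Ω × A) : ℝ :=
  ∏ t, μ (y t).1 * alg (hist (fun s => (y s).1) t) (y t).1 (y t).2

theorem hist_zero {Ω : Type*} [Fintype Ω] {n : ℕ} (x : Fin (n + 1) → Ω) : hist x 0 = [] := rfl

theorem hist_cons_succ {Ω : Type*} [Fintype Ω] {n : ℕ} (ω : Ω) (x : Fin n → Ω) (t : Fin n) :
    hist (Fin.cons ω x : Fin (n + 1) → Ω) t.succ = ω :: hist x t :=
  List.ofFn_succ

theorem length_hist {Ω : Type*} [Fintype Ω] {n : ℕ} (x : Fin n → Ω) (t : Fin n) :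
    (hist x t).length = t :=
  List.length_ofFn

theorem count_hist {Ω : Type*} [Fintype Ω] [DecidableEq Ω] {n : ℕ} (x : Fin n → Ω) (t : Fin n)
    (ω : Ω) : ((hist x t).count ω : ℝ)
      = ∑ i : Fin n, (if i.1 < t.1 then (1 : ℝ) else 0) * (if x i = ω then 1 else 0) := by
  induction n with
  | zero => exact t.elim0
  | succ n ih =>
    obtain ⟨a, x, rfl⟩ : ∃ a y, x = Fin.cons a y := ⟨x 0, Fin.tail x, (Fin.cons_self_tail x).symm⟩
    induction t using Fin.cases with
    | zero => simp [hist_zero]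
    | succ t =>
      rw [hist_cons_succ, List.count_cons, Fin.sum_univ_succ]
      simp only [Fin.cons_zero, Fin.cons_succ, Fin.val_succ, Nat.add_lt_add_iff_right,
        Fin.val_zero, Nat.succ_pos, if_true, ← ih]
      push_cast
      simp [add_comm]

theorem isDist_empList {Ω : Type*} [Fintype Ω] [DecidableEq Ω] {γ0 : Ω → ℝ} (hγ0 : IsDist γ0)
    (h : List Ω) : IsDist (empList γ0 h) := by
  unfold empList
  split_ifs with hl
  · exact hγ0
  · refine ⟨fun ω => by positivity, ?_⟩
    rw [← Finset.sum_div, div_eq_one_iff_eq (by exact_mod_cast hl)]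
    have := Multiset.sum_count_eq_card (s := Finset.univ) (m := (h : Multiset Ω))
      fun a _ => Finset.mem_univ a
    simp only [Multiset.coe_count, Multiset.coe_card] at this
    exact_mod_cast this

theorem mul_dist1_empList_hist {Ω : Type*} [Fintype Ω] [DecidableEq Ω] (γ0 μ : Ω → ℝ) {n : ℕ}
    (x : Fin n → Ω) (t : Fin n) (ht : 1 ≤ t.1) :
    t * dist1 (empList γ0 (hist x t)) μ = countDev μ t x := by
  have ht0 : (0 : ℝ) < t.1 := by exact_mod_cast ht
  rw [dist1, countDev, Finset.mul_sum]
  refine Finset.sum_congr rfl fun ω _ => ?_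
  rw [← abs_of_pos ht0, ← abs_mul]
  congr 1
  simp only [mul_sub, Finset.sum_sub_distrib, ← count_hist, ← Finset.sum_mul,
    sum_ite_val_lt t.2.le]
  rw [empList, length_hist, if_neg (by omega)]
  field_simp

theorem isDist_step {Ω A : Type*} [Fintype Ω] [Fintype A] {μ : Ω → ℝ} (hμ : IsDist μ)
    {σ : Ω → A → ℝ} (hσ : IsMech σ) : IsDist fun p : Ω × A => μ p.1 * σ p.1 p.2 := by
  refine ⟨fun p => mul_nonneg (hμ.1 _) ((hσ _).1 _), ?_⟩
  rw [Fintype.sum_prod_type]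
  simp only [← Finset.mul_sum, (hσ _).2, mul_one, hμ.2]

theorem states_cons {Ω A : Type*} {n : ℕ} (p : Ω × A) (y : Fin n → Ω × A) :
    (fun s => ((Fin.cons p y : Fin (n + 1) → Ω × A) s).1) = Fin.cons p.1 fun s => (y s).1 := by
  funext s
  induction s using Fin.cases <;> simp

theorem jointWeight_cons {Ω A : Type*} [Fintype Ω] {n : ℕ} (μ : Ω → ℝ)
    (alg : List Ω → Ω → A → ℝ) (p : Ω × A) (y : Fin n → Ω × A) :
    jointWeight μ alg (Fin.cons p y : Fin (n + 1) → Ω × A)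
      = μ p.1 * alg [] p.1 p.2 * jointWeight μ (fun h => alg (p.1 :: h)) y := by
  rw [jointWeight, Fin.prod_univ_succ, states_cons]
  simp only [Fin.cons_zero, Fin.cons_succ, hist_zero, hist_cons_succ]
  rfl

theorem jointWeight_nonneg {Ω A : Type*} [Fintype A] {n : ℕ} {μ : Ω → ℝ} (hμ : ∀ ω, 0 ≤ μ ω)
    {alg : List Ω → Ω → A → ℝ} (halg : ∀ h, IsMech (alg h)) (y : Fin n → Ω × A) :
    0 ≤ jointWeight μ alg y :=
  Finset.prod_nonneg fun _ _ => mul_nonneg (hμ _) ((halg _ _).1 _)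

theorem sum_jointWeight_mul_states {Ω A : Type*} [Fintype Ω] [Fintype A] {n : ℕ} (μ : Ω → ℝ)
    {alg : List Ω → Ω → A → ℝ} (halg : ∀ h, IsMech (alg h)) (g : (Fin n → Ω) → ℝ) :
    ∑ y : Fin n → Ω × A, jointWeight μ alg y * g (fun s => (y s).1)
      = ∑ x : Fin n → Ω, (∏ i, μ (x i)) * g x := by
  induction n generalizing alg with
  | zero =>
    simp only [jointWeight, Finset.univ_unique, Finset.sum_singleton, Finset.prod_of_isEmpty]
    congr 2
    exact Subsingleton.elim _ _
  | succ n ih =>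
    rw [sum_pi_fin_succ, sum_pi_fin_succ, Fintype.sum_prod_type]
    refine Finset.sum_congr rfl fun ω _ => ?_
    simp only [states_cons, jointWeight_cons, mul_assoc, ← Finset.mul_sum]
    simp only [ih (fun h => halg (ω :: h)) fun x => g (Fin.cons ω x), ← Finset.sum_mul,
      (halg [] ω).2, one_mul, Fin.prod_univ_succ, Fin.cons_zero, Fin.cons_succ, mul_assoc,
      ← Finset.mul_sum]

theorem sum_jointWeight_mul_exp_le {Ω A : Type*} [Fintype Ω] [Fintype A]
    {v : Ω → A → ℝ} (hv : ∀ ω a, v ω a ∈ Set.Icc (0 : ℝ) 1) {μ : Ω → ℝ} (hμ : IsDist μ) {n : ℕ}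
    {alg : List Ω → Ω → A → ℝ} (halg : ∀ h, IsMech (alg h)) {r : ℝ} (hr : 0 ≤ r) :
    ∑ y : Fin n → Ω × A, jointWeight μ alg y * Real.exp (r * ∑ t,
        (Val v μ (alg (hist (fun s => (y s).1) t)) - v (y t).1 (y t).2))
      ≤ Real.exp (n * (r ^ 2 / 8)) := by
  induction n generalizing alg with
  | zero => simp [jointWeight]
  | succ n ih =>
    have hstep : ∑ p : Ω × A, μ p.1 * alg [] p.1 p.2 *
        Real.exp (r * (Val v μ (alg []) - v p.1 p.2)) ≤ Real.exp (r ^ 2 / 8) := by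
      have hd := isDist_step hμ (halg [])
      refine (sum_mul_exp_le hd (c := r) fun p q => ?_).trans_eq ?_
      · nlinarith [(hv p.1 p.2).1, (hv q.1 q.2).2]
      · have h0 : ∑ p : Ω × A, μ p.1 * alg [] p.1 p.2 * (r * (Val v μ (alg []) - v p.1 p.2))
            = r * (Val v μ (alg []) * ∑ p : Ω × A, μ p.1 * alg [] p.1 p.2
              - ∑ p : Ω × A, μ p.1 * alg [] p.1 p.2 * v p.1 p.2) := by
          rw [Finset.mul_sum, ← Finset.sum_sub_distrib, Finset.mul_sum]
          exact Finset.sum_congr rfl fun p _ => by ring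
        rw [h0, hd.2, Fintype.sum_prod_type]
        simp [Val]
    rw [sum_pi_fin_succ]
    simp only [Fin.sum_univ_succ, states_cons, jointWeight_cons, Fin.cons_zero, Fin.cons_succ,
      hist_zero, hist_cons_succ]
    calc _ = ∑ p : Ω × A, μ p.1 * alg [] p.1 p.2 *
            Real.exp (r * (Val v μ (alg []) - v p.1 p.2)) * ∑ y : Fin n → Ω × A,
            jointWeight μ (fun h => alg (p.1 :: h)) y * Real.exp (r * ∑ t,
              (Val v μ (alg (p.1 :: hist (fun s => (y s).1) t)) - v (y t).1 (y t).2)) := by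
          refine Finset.sum_congr rfl fun p _ => ?_
          rw [Finset.mul_sum]
          refine Finset.sum_congr rfl fun y _ => ?_
          rw [mul_add, Real.exp_add]
          ring
      _ ≤ ∑ p : Ω × A, μ p.1 * alg [] p.1 p.2 *
            Real.exp (r * (Val v μ (alg []) - v p.1 p.2)) * Real.exp (n * (r ^ 2 / 8)) := by
          refine Finset.sum_le_sum fun p _ => mul_le_mul_of_nonneg_left
            (ih fun h => halg (p.1 :: h)) (mul_nonneg ?_ (Real.exp_nonneg _))
          exact mul_nonneg (hμ.1 _) ((halg [] _).1 _)
      _ ≤ Real.exp (r ^ 2 / 8) * Real.exp (n * (r ^ 2 / 8)) := by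
          rw [← Finset.sum_mul]
          exact mul_le_mul_of_nonneg_right hstep (Real.exp_nonneg _)
      _ = _ := by
          rw [← Real.exp_add]
          push_cast
          ring_nf

theorem sum_prod_mul_exp_countDev_sub_le {Ω : Type*} [Fintype Ω] [DecidableEq Ω] {μ : Ω → ℝ}
    (hμ : IsDist μ) {n t : ℕ} (ht1 : 1 ≤ t) (ht : t ≤ n) {s : ℝ} (hs : 0 ≤ s) :
    ∑ x : Fin n → Ω, (∏ i, μ (x i)) * Real.exp (s * √(Fintype.card Ω) / √t *
        (countDev μ t x - √(Fintype.card Ω * t) * (1 + s)))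
      ≤ Real.exp (-(Fintype.card Ω * s ^ 2 / 2)) := by
  set N : ℝ := (Fintype.card Ω : ℝ)
  have hN : 0 ≤ N := Nat.cast_nonneg _
  have ht0 : (0 : ℝ) < t := by exact_mod_cast ht1
  have htt := Real.sq_sqrt ht0.le
  have hNN := Real.sq_sqrt hN
  have hst : √(t : ℝ) ≠ 0 := (Real.sqrt_pos.2 ht0).ne'
  set r := s * √N / √t with hr
  have h1 : r * √(N * t) = s * N := by
    rw [hr, Real.sqrt_mul hN]
    field_simp
    rw [hNN]
  have h2 : r ^ 2 * t = s ^ 2 * N := by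
    rw [hr, div_pow, mul_pow, htt, hNN]
    field_simp
  have h := sum_prod_mul_exp_countDev_le hμ ht (r := r) (by positivity)
  calc _ = (∑ x : Fin n → Ω, (∏ i, μ (x i)) * Real.exp (r * countDev μ t x))
          * Real.exp (-(r * √(N * t) * (1 + s))) := by
        rw [Finset.sum_mul]
        refine Finset.sum_congr rfl fun x _ => ?_
        rw [mul_assoc, ← Real.exp_add]
        ring_nf
    _ ≤ _ := by
        refine (mul_le_mul_of_nonneg_right h (Real.exp_nonneg _)).trans ?_
        rw [← Real.exp_add, Real.exp_le_exp]
        change r * √(N * t) + r ^ 2 * t / 2 + -(r * √(N * t) * (1 + s)) ≤ _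
        rw [h1, h2]
        linarith

theorem sum_jointWeight_mul_exp_sub_le {Ω A : Type*} [Fintype Ω] [Fintype A]
    {v : Ω → A → ℝ} (hv : ∀ ω a, v ω a ∈ Set.Icc (0 : ℝ) 1) {μ : Ω → ℝ} (hμ : IsDist μ) {n : ℕ}
    (hn : 0 < n) {alg : List Ω → Ω → A → ℝ} (halg : ∀ h, IsMech (alg h)) {s N : ℝ} (hs : 0 ≤ s)
    (hN : 0 ≤ N) :
    ∑ y : Fin n → Ω × A, jointWeight μ alg y * Real.exp (8 * s * √N / √n * (∑ t,
        (Val v μ (alg (hist (fun s => (y s).1) t)) - v (y t).1 (y t).2) - 2 * √(N * n) * s))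
      ≤ Real.exp (-(8 * N * s ^ 2)) := by
  have hn0 : (0 : ℝ) < n := by exact_mod_cast hn
  have hnn := Real.sq_sqrt hn0.le
  have hNN := Real.sq_sqrt hN
  have hsn : √(n : ℝ) ≠ 0 := (Real.sqrt_pos.2 hn0).ne'
  set r := 8 * s * √N / √n with hr
  have h1 : r * √(N * n) = 8 * s * N := by
    rw [hr, Real.sqrt_mul hN]
    field_simp
    rw [hNN]
  have h2 : n * r ^ 2 = 64 * s ^ 2 * N := by
    rw [hr, div_pow, mul_pow, hnn, hNN]
    field_simp
    ring
  have h := sum_jointWeight_mul_exp_le hv hμ (n := n) halg (r := r) (by positivity)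
  calc _ = (∑ y : Fin n → Ω × A, jointWeight μ alg y * Real.exp (r * ∑ t,
        (Val v μ (alg (hist (fun s => (y s).1) t)) - v (y t).1 (y t).2)))
          * Real.exp (-(2 * (r * √(N * n)) * s)) := by
        rw [Finset.sum_mul]
        refine Finset.sum_congr rfl fun x _ => ?_
        rw [mul_assoc (jointWeight μ alg x) (Real.exp _), ← Real.exp_add]
        ring_nf
    _ ≤ _ := by
        refine (mul_le_mul_of_nonneg_right h (Real.exp_nonneg _)).trans ?_
        rw [← Real.exp_add, Real.exp_le_exp, h1]
        linarith

theorem sum_range_one_div_sqrt_le (m : ℕ) :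
    ∑ t ∈ Finset.range (m + 1), 1 / √(t : ℝ) ≤ 2 * √(m : ℝ) := by
  induction m with
  | zero => simp
  | succ m ih =>
    rw [Finset.sum_range_succ]
    refine (add_le_add_left ih _).trans ?_
    have hpos : 0 < √((m + 1 : ℕ) : ℝ) := Real.sqrt_pos.2 (by positivity)
    have h1 : √((m + 1 : ℕ) : ℝ) ^ 2 = m + 1 := by
      rw [Real.sq_sqrt (by positivity)]; push_cast; ring
    have h2 : √(m : ℝ) ^ 2 = m := Real.sq_sqrt (Nat.cast_nonneg m)
    rw [← sub_nonneg]
    have : 2 * √((m + 1 : ℕ) : ℝ) - (2 * √(m : ℝ) + 1 / √((m + 1 : ℕ) : ℝ))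
        = (√((m + 1 : ℕ) : ℝ) - √(m : ℝ)) ^ 2 / √((m + 1 : ℕ) : ℝ) := by
      field_simp
      nlinarith
    rw [this]
    positivity

theorem sum_radius_le {ε : ℕ → ℝ} {T : ℕ} (hT : 1 ≤ T) {N s : ℝ} (hN : 0 ≤ N) (hs : 0 ≤ s)
    (hε0 : ε 0 = 2)
    (hεt : ∀ t : ℕ, 1 ≤ t → ε t = min (√(N / t) * (1 + s)) 2) :
    ∑ t : Fin T, ε t ≤ 2 * (1 + √(N * T) * (1 + s)) := by
  obtain ⟨m, rfl⟩ : ∃ m, T = m + 1 := ⟨T - 1, by omega⟩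
  have hle : ∀ t, ε t ≤ (if t = 0 then 2 else 0) + √N * (1 + s) * (1 / √(t : ℝ)) := by
    intro t
    rcases Nat.eq_zero_or_pos t with rfl | ht
    · simp [hε0]
    · rw [hεt t ht, if_neg ht.ne', zero_add, Real.sqrt_div hN]
      refine (min_le_left _ _).trans_eq ?_
      ring
  rw [← Finset.sum_range fun t => ε t]
  refine (Finset.sum_le_sum fun t _ => hle t).trans ?_
  rw [Finset.sum_add_distrib, ← Finset.mul_sum, Real.sqrt_mul hN]
  have h1 : ∑ t ∈ Finset.range (m + 1), (if t = 0 then (2 : ℝ) else 0) = 2 := by simp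
  have h2 : ∑ t ∈ Finset.range (m + 1), 1 / √(t : ℝ) ≤ 2 * √((m + 1 : ℕ) : ℝ) :=
    (sum_range_one_div_sqrt_le m).trans
      (mul_le_mul_of_nonneg_left (Real.sqrt_le_sqrt (by push_cast; linarith)) zero_le_two)
  have h3 := mul_le_mul_of_nonneg_left h2 (show 0 ≤ √N * (1 + s) by positivity)
  linarith

theorem le_half_of_forall_le {Ω : Type*} [Fintype Ω] (hc : 2 ≤ Fintype.card Ω) {μ : Ω → ℝ}
    (hμ : IsDist μ) {p0 : ℝ} (hp0 : 0 < p0) (hμp : ∀ ω, p0 ≤ μ ω) : p0 ≤ 1 / 2 := by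
  have h : ∑ _ω : Ω, p0 ≤ 1 := (Finset.sum_le_sum fun ω _ => hμp ω).trans_eq hμ.2
  rw [Finset.sum_const, Finset.card_univ, nsmul_eq_mul] at h
  have : (2 : ℝ) ≤ Fintype.card Ω := by exact_mod_cast hc
  nlinarith

theorem regret_le_of_good {Ω A : Type*} [Fintype Ω] [Fintype A] [DecidableEq Ω] [Nonempty A]
    {u v : Ω → A → ℝ} (hv : ∀ ω a, v ω a ∈ Set.Icc (0 : ℝ) 1) {D : ℝ} (hD : 0 < D)
    (hreg : ∀ a : A, ∃ η : Ω → ℝ, η ∈ Popt u a ∧ ball1 η D ⊆ Popt u a)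
    {p0 : ℝ} (hp0 : 0 < p0) (hp0' : p0 ≤ 1 / 2) {T : ℕ} (hT : 1 ≤ T) {s : ℝ} (hs : 0 ≤ s)
    {ε : ℕ → ℝ} (hε0 : ε 0 = 2)
    (hεt : ∀ t : ℕ, 1 ≤ t → ε t = min (√((Fintype.card Ω : ℝ) / t) * (1 + s)) 2)
    {μ : Ω → ℝ} (hμ : IsDist μ) (hμp : ∀ ω, p0 ≤ μ ω) {γ0 : Ω → ℝ} (hγ0 : IsDist γ0)
    {alg : List Ω → Ω → A → ℝ} (halgM : ∀ h, IsMech (alg h))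
    (halgO : ∀ h : List Ω, ∀ σ : Ω → A → ℝ,
      IsMech σ → PersOn u (ball1 (empList γ0 h) (ε h.length)) σ →
      Val v (empList γ0 h) σ ≤ Val v (empList γ0 h) (alg h))
    {y : Fin T → Ω × A}
    (hdev : ∀ t : Fin T, 1 ≤ t.1 →
      countDev μ t (fun i => (y i).1) ≤ √((Fintype.card Ω : ℝ) * t) * (1 + s))
    (hval : ∑ t, (Val v μ (alg (hist (fun i => (y i).1) t)) - v (y t).1 (y t).2)
      ≤ 2 * √((Fintype.card Ω : ℝ) * T) * s) :
    (T : ℝ) * OPT u v μ - ∑ t : Fin T, v (y t).1 (y t).2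
      ≤ 2 * (20 / (p0 ^ 2 * D) + 1) *
          (1 + √((Fintype.card Ω : ℝ) * T) * (1 + 2 * s)) := by
  have hN : (0 : ℝ) ≤ Fintype.card Ω := Nat.cast_nonneg _
  have hstep : ∀ t : Fin T, OPT u v μ - Val v μ (alg (hist (fun i => (y i).1) t))
      ≤ (20 / (p0 ^ 2 * D) + 1) * ε t := by
    intro t
    have hγ := isDist_empList hγ0 (hist (fun i => (y i).1) t)
    have h2 := dist1_le_two hγ hμ
    have hO := halgO (hist (fun i => (y i).1) t)
    rw [length_hist] at hO
    refine opt_sub_val_le hv hD hreg hp0 hp0' hμ hμp hγ ?_ ?_ (halgM _) hO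
    · rcases Nat.eq_zero_or_pos t.1 with ht | ht
      · rw [ht, hε0]; norm_num
      · rw [hεt _ ht]; positivity
    · rcases Nat.eq_zero_or_pos t.1 with ht | ht
      · rwa [ht, hε0]
      · rw [hεt _ ht]
        refine le_min ?_ h2
        have ht0 : (0 : ℝ) < t.1 := by exact_mod_cast ht
        have h := hdev t ht
        rw [← mul_dist1_empList_hist γ0 μ _ t ht] at h
        refine le_of_mul_le_mul_left (h.trans_eq ?_) ht0
        rw [Real.sqrt_mul hN, Real.sqrt_div hN, ← mul_assoc]
        congr 1
        rw [mul_div_assoc', eq_div_iff (Real.sqrt_pos.2 ht0).ne', mul_assoc,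
          Real.mul_self_sqrt ht0.le, mul_comm]
  have hsum := Finset.sum_le_sum fun t (_ : t ∈ Finset.univ) => hstep t
  rw [← Finset.mul_sum, Finset.sum_sub_distrib, Finset.sum_const, Finset.card_univ,
    Fintype.card_fin, nsmul_eq_mul] at hsum
  rw [Finset.sum_sub_distrib] at hval
  have hk : 0 ≤ 20 / (p0 ^ 2 * D) := by positivity
  have hε := mul_le_mul_of_nonneg_left (sum_radius_le hT hN hs hε0 hεt)
    (show 0 ≤ 20 / (p0 ^ 2 * D) + 1 by linarith)
  have hextra : 0 ≤ 20 / (p0 ^ 2 * D) * (√((Fintype.card Ω : ℝ) * T) * s) := by positivity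
  linarith

/-- Theorem 2 (regret upper bound for the RAI algorithm): under the regularity conditions
with constants `D > 0` and `p0 > 0`, with `ε_t = min{√(|Ω|/t)(1 + √(Φ log T)), 2}` (and
`ε_0 = 2`), if at each history `h` the algorithm plays a mechanism maximizing
`V(γ_{|h|}, ·)` over mechanisms persuasive on `B₁(γ_{|h|}, ε_{|h|})` (where `γ_t` is the
empirical distribution of `h`, and `γ_0 ∈ B₀`), then for every prior `μ* ∈ B₀`, with
probability at least `1 − T^{1−3Φ√|Ω|/56} − T^{−8Φ|Ω|}`, the regret is at most
`2·(20/(p0²D) + 1)·(1 + √(|Ω|T)(1 + 2√(Φ log T)))`. -/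
theorem stmt1 {Ω A : Type*} [Fintype Ω] [Fintype A] [DecidableEq Ω]
    (hcΩ : 2 ≤ Fintype.card Ω) (hcA : 2 ≤ Fintype.card A)
    (u : Ω → A → ℝ) (v : Ω → A → ℝ) (hv : ∀ ω a, v ω a ∈ Set.Icc (0 : ℝ) 1)
    (D : ℝ) (hD : 0 < D)
    (hreg : ∀ a : A, ∃ η : Ω → ℝ, η ∈ Popt u a ∧ ball1 η D ⊆ Popt u a)
    (p0 : ℝ) (hp0 : 0 < p0)
    (T : ℕ) (hT : 2 ≤ T) (Φ : ℝ) (hΦ : 0 < Φ)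
    (ε : ℕ → ℝ) (hε0 : ε 0 = 2)
    (hεt : ∀ t : ℕ, 1 ≤ t →
      ε t = min (Real.sqrt ((Fintype.card Ω : ℝ) / t) * (1 + Real.sqrt (Φ * Real.log T))) 2)
    (μstar : Ω → ℝ) (hμ : IsDist μstar) (hμp : ∀ ω, p0 ≤ μstar ω)
    (γ0 : Ω → ℝ) (hγ0 : IsDist γ0) (hγ0p : ∀ ω, p0 ≤ γ0 ω)
    (alg : List Ω → Ω → A → ℝ)
    (halgM : ∀ h, IsMech (alg h))
    (halgP : ∀ h : List Ω, PersOn u (ball1 (empList γ0 h) (ε h.length)) (alg h))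
    (halgO : ∀ h : List Ω, ∀ σ : Ω → A → ℝ,
      IsMech σ → PersOn u (ball1 (empList γ0 h) (ε h.length)) σ →
      Val v (empList γ0 h) σ ≤ Val v (empList γ0 h) (alg h)) :
    1 - (T : ℝ) ^ (1 - 3 * Φ * Real.sqrt (Fintype.card Ω) / 56)
        - (T : ℝ) ^ (-(8 * Φ * (Fintype.card Ω : ℝ)))
      ≤ jointProb μstar alg
          {x : Fin T → Ω × A |
            (T : ℝ) * OPT u v μstar - ∑ t : Fin T, v (x t).1 (x t).2
              ≤ 2 * (20 / (p0 ^ 2 * D) + 1) *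
                  (1 + Real.sqrt ((Fintype.card Ω : ℝ) * T)
                        * (1 + 2 * Real.sqrt (Φ * Real.log T)))} := by
  have hA : Nonempty A := Fintype.card_pos_iff.1 (by omega)
  set N : ℝ := (Fintype.card Ω : ℝ) with hNdef
  set s := Real.sqrt (Φ * Real.log T) with hs
  have hN : 1 ≤ N := by
    rw [hNdef]; exact_mod_cast (by omega : 1 ≤ Fintype.card Ω)
  have hT0 : (0 : ℝ) < T := by exact_mod_cast (by omega : 0 < T)
  have hlog : 0 ≤ Real.log T := Real.log_natCast_nonneg T
  have hs0 : 0 ≤ s := Real.sqrt_nonneg _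
  have hss : s ^ 2 = Φ * Real.log T := Real.sq_sqrt (by positivity)
  set E : Set (Fin T → Ω × A) := {x : Fin T → Ω × A |
    (T : ℝ) * OPT u v μstar - ∑ t : Fin T, v (x t).1 (x t).2
      ≤ 2 * (20 / (p0 ^ 2 * D) + 1) * (1 + Real.sqrt (N * T) * (1 + 2 * s))} with hE
  set f : Fin T → (Fin T → Ω) → ℝ := fun t x => if 1 ≤ t.1 then
    Real.exp (s * √N / √(t.1 : ℝ) * (countDev μstar t x - √(N * t.1) * (1 + s))) else 0 with hf
  set g : (Fin T → Ω × A) → ℝ := fun y => Real.exp (8 * s * √N / √(T : ℝ) * (∑ t,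
    (Val v μstar (alg (hist (fun s => (y s).1) t)) - v (y t).1 (y t).2)
      - 2 * √(N * T) * s)) with hg
  have hf0 : ∀ t x, 0 ≤ f t x := fun t x => by
    simp only [hf]
    split_ifs
    · exact Real.exp_nonneg _
    · exact le_rfl
  have hpoint : ∀ y : Fin T → Ω × A, jointWeight μstar alg y *
      (1 - ∑ t, f t (fun i => (y i).1) - g y) ≤ Set.indicator E (jointWeight μstar alg) y := by
    intro y
    have hw := jointWeight_nonneg hμ.1 halgM y
    by_cases hy : y ∈ E
    · rw [Set.indicator_of_mem hy]
      refine mul_le_of_le_one_right hw ?_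
      have h1 : 0 ≤ ∑ t, f t (fun i => (y i).1) := Finset.sum_nonneg fun t _ => hf0 t _
      have h2 : 0 ≤ g y := Real.exp_nonneg _
      linarith
    · rw [Set.indicator_of_notMem hy]
      refine mul_nonpos_of_nonneg_of_nonpos hw ?_
      by_cases hdev : ∀ t : Fin T, 1 ≤ t.1 →
          countDev μstar t (fun i => (y i).1) ≤ √(N * t) * (1 + s)
      · have hval : 2 * √(N * T) * s
            < ∑ t, (Val v μstar (alg (hist (fun i => (y i).1) t)) - v (y t).1 (y t).2) := by
          by_contra! hval
          exact hy (regret_le_of_good hv hD hreg hp0 (le_half_of_forall_le hcΩ hμ hp0 hμp)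
            (by omega) hs0 hε0 hεt hμ hμp hγ0 halgM halgO hdev hval)
        have h1 : 0 ≤ ∑ t, f t (fun i => (y i).1) := Finset.sum_nonneg fun t _ => hf0 t _
        have h2 : 1 ≤ g y := Real.one_le_exp (mul_nonneg (by positivity) (by linarith))
        linarith
      · push Not at hdev
        obtain ⟨t, ht, hlt⟩ := hdev
        have h1 : 1 ≤ f t (fun i => (y i).1) := by
          simp only [hf, if_pos ht]
          exact Real.one_le_exp (mul_nonneg (by positivity) (by linarith))
        have h2 : f t (fun i => (y i).1) ≤ ∑ t, f t (fun i => (y i).1) :=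
          Finset.single_le_sum (f := fun t => f t (fun i => (y i).1))
            (fun t _ => hf0 t _) (Finset.mem_univ t)
        have h3 : 0 ≤ g y := Real.exp_nonneg _
        linarith
  have hsum1 : ∑ y : Fin T → Ω × A, jointWeight μstar alg y = 1 := by
    have h := sum_jointWeight_mul_states (n := T) μstar halgM fun _ => 1
    simp only [mul_one] at h
    rw [h, (isDist_prod hμ T).2]
  have hsumf : ∀ t, ∑ y : Fin T → Ω × A, jointWeight μstar alg y * f t (fun i => (y i).1)
      ≤ Real.exp (-(3 * √N / 56 * s ^ 2)) := by
    intro t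
    rw [sum_jointWeight_mul_states μstar halgM (f t)]
    by_cases ht : 1 ≤ t.1
    · simp only [hf, if_pos ht]
      refine (sum_prod_mul_exp_countDev_sub_le hμ ht t.2.le hs0).trans ?_
      rw [Real.exp_le_exp, neg_le_neg_iff]
      have h1 : √N ≤ N := Real.sqrt_le_iff.2 ⟨by linarith, by nlinarith⟩
      nlinarith [mul_le_mul_of_nonneg_right h1 (sq_nonneg s),
        mul_nonneg (zero_le_one.trans hN) (sq_nonneg s)]
    · simp only [hf, if_neg ht, mul_zero, Finset.sum_const_zero]
      exact Real.exp_nonneg _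
  have hsumg : ∑ y : Fin T → Ω × A, jointWeight μstar alg y * g y
      ≤ Real.exp (-(8 * N * s ^ 2)) :=
    sum_jointWeight_mul_exp_sub_le hv hμ (by omega) halgM hs0 (zero_le_one.trans hN)
  have hpow1 : (T : ℝ) ^ (1 - 3 * Φ * Real.sqrt N / 56)
      = T * Real.exp (-(3 * √N / 56 * s ^ 2)) := by
    rw [Real.rpow_def_of_pos hT0, hss, mul_sub, mul_one, sub_eq_add_neg, Real.exp_add,
      Real.exp_log hT0]
    ring_nf
  have hpow2 : (T : ℝ) ^ (-(8 * Φ * N)) = Real.exp (-(8 * N * s ^ 2)) := by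
    rw [Real.rpow_def_of_pos hT0, hss]
    ring_nf
  have hmain := Finset.sum_le_sum fun y (_ : y ∈ Finset.univ) => hpoint y
  simp only [mul_sub, mul_one, Finset.sum_sub_distrib, hsum1, Finset.mul_sum] at hmain
  rw [Finset.sum_comm] at hmain
  have hsumf' := Finset.sum_le_sum fun t (_ : t ∈ Finset.univ) => hsumf t
  rw [Finset.sum_const, Finset.card_univ, Fintype.card_fin, nsmul_eq_mul] at hsumf'
  rw [hpow1, hpow2]
  change _ ≤ ∑ y, Set.indicator E (jointWeight μstar alg) y
  linarith
end

section
/- Gap bound at an approximate prior: assume the regularity condition with constant D > 0, and let p0 > 0. Let μ ∈ Δ(Ω) with min_ω μ(ω) ≥ p0, let ε ≥ 0, and let γ ∈ Δ(Ω) with ‖γ − μ‖₁ ≤ ε. Then GAP(γ, B₁(γ, ε)) ≤ (16/(p0²·D))·ε, where GAP(μ, B) := sup_{σ ∈ Pers(μ)} V(μ,σ) − sup_{σ ∈ Pers(B)} V(μ,σ). -/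
section Persuasion

variable {Ω A : Type*} [Fintype Ω] [Fintype A]

/-- A nonnegative vector whose normalisation lies within `D` of `η` has nonnegative obedience
slack for `a`, whenever `Popt u a` contains the ball of radius `D` around `η`. -/
lemma sum_mul_sub_nonneg_of_near {u : Ω → A → ℝ} {a : A} {η : Ω → ℝ} {D : ℝ}
    (hη : ball1 η D ⊆ Popt u a) {z : Ω → ℝ} (hz : ∀ ω, 0 ≤ z ω)
    (hzη : ∑ ω, |z ω - (∑ i, z i) * η ω| ≤ D * ∑ i, z i) (a' : A) :
    0 ≤ ∑ ω, z ω * (u ω a - u ω a') := by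
  rcases (Finset.sum_nonneg fun i (_ : i ∈ Finset.univ) => hz i).eq_or_lt with hT | hT
  · have h0 := (Finset.sum_eq_zero_iff_of_nonneg fun i _ => hz i).1 hT.symm
    exact (Finset.sum_eq_zero fun ω hω => by rw [h0 ω hω, zero_mul]).ge
  · set T := ∑ i, z i with hTdef
    have hmem : (fun ω => z ω / T) ∈ ball1 η D := by
      refine ⟨⟨fun ω => div_nonneg (hz ω) hT.le, ?_⟩, ?_⟩
      · rw [← Finset.sum_div, ← hTdef, div_self hT.ne']
      · have heq : ∀ ω, |z ω / T - η ω| = |z ω - T * η ω| / T := fun ω => by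
          rw [div_sub' hT.ne', abs_div, abs_of_pos hT]
        simp only [dist1, heq]
        rw [← Finset.sum_div, div_le_iff₀ hT]
        exact hzη
    have h := (hη hmem).2 a'
    have heq : ∑ ω, z ω * (u ω a - u ω a')
        = T * (∑ ω, z ω / T * u ω a - ∑ ω, z ω / T * u ω a') := by
      rw [← Finset.sum_sub_distrib, Finset.mul_sum]
      refine Finset.sum_congr rfl fun ω _ => ?_
      field_simp
    rw [heq]
    exact mul_nonneg hT.le (sub_nonneg.2 h)

/-- Crude bound on the distance from a nonnegative vector to the multiple of a distribution
with the same mass. -/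
lemma sum_abs_sub_mass_mul_le {η z : Ω → ℝ} (hη : IsDist η) (hz : ∀ ω, 0 ≤ z ω) :
    ∑ ω, |z ω - (∑ i, z i) * η ω| ≤ 2 * ∑ i, z i := by
  have hT : 0 ≤ ∑ i, z i := Finset.sum_nonneg fun i _ => hz i
  calc ∑ ω, |z ω - (∑ i, z i) * η ω| ≤ ∑ ω, (z ω + (∑ i, z i) * η ω) := by
        refine Finset.sum_le_sum fun ω _ => ?_
        have := mul_nonneg hT (hη.1 ω)
        have := hz ω
        rw [abs_le]
        constructor <;> linarith
    _ = 2 * ∑ i, z i := by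
        rw [Finset.sum_add_distrib, ← Finset.mul_sum, hη.2]
        ring

lemma abs_sub_le_of_dist1_le {μ ν : Ω → ℝ} {ε : ℝ} (h : dist1 μ ν ≤ ε) (ω : Ω) :
    |μ ω - ν ω| ≤ ε :=
  (Finset.single_le_sum (f := fun ω => |μ ω - ν ω|) (fun _ _ => abs_nonneg _)
    (Finset.mem_univ ω)).trans h

lemma Val_nonneg {v : Ω → A → ℝ} (hv : ∀ ω a, v ω a ∈ Set.Icc (0 : ℝ) 1) {γ : Ω → ℝ}
    (hγ : IsDist γ) {σ : Ω → A → ℝ} (hσ : IsMech σ) : 0 ≤ Val v γ σ :=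
  Finset.sum_nonneg fun ω _ => Finset.sum_nonneg fun a _ =>
    mul_nonneg (mul_nonneg (hγ.1 ω) ((hσ ω).1 a)) (hv ω a).1

lemma Val_le_one {v : Ω → A → ℝ} (hv : ∀ ω a, v ω a ∈ Set.Icc (0 : ℝ) 1) {γ : Ω → ℝ}
    (hγ : IsDist γ) {σ : Ω → A → ℝ} (hσ : IsMech σ) : Val v γ σ ≤ 1 := by
  calc Val v γ σ ≤ ∑ ω, ∑ a, γ ω * σ ω a :=
        Finset.sum_le_sum fun ω _ => Finset.sum_le_sum fun a _ =>
          mul_le_of_le_one_right (mul_nonneg (hγ.1 ω) ((hσ ω).1 a)) (hv ω a).2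
    _ = 1 := by
        simp only [← Finset.mul_sum, (hσ _).2, mul_one]
        exact hγ.2

/-- The gap is at most `c` as soon as every persuasive mechanism can be made robust at a loss of
at most `c`. -/
lemma GAP_le_of_forall_exists {u v : Ω → A → ℝ} (hv : ∀ ω a, v ω a ∈ Set.Icc (0 : ℝ) 1)
    {γ : Ω → ℝ} (hγ : IsDist γ) {B : Set (Ω → ℝ)} {c : ℝ} (hc : 0 ≤ c)
    (h : ∀ σ, IsMech σ → Pers u γ σ →
      1 ≤ c ∨ ∃ σ', IsMech σ' ∧ PersOn u B σ' ∧ Val v γ σ ≤ Val v γ σ' + c) :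
    GAP u v γ B ≤ c := by
  have hR : 0 ≤ OPTRobust u v γ B := by
    refine Real.sSup_nonneg ?_
    rintro _ ⟨σ, hσ, rfl⟩
    exact Val_nonneg hv hγ hσ.1
  rw [GAP, sub_le_iff_le_add']
  refine Real.sSup_le ?_ (add_nonneg hR hc)
  rintro _ ⟨σ, ⟨hσ, hP⟩, rfl⟩
  rcases h σ hσ hP with h1 | ⟨σ', hσ', hP', hle⟩
  · linarith [Val_le_one hv hγ hσ]
  · refine hle.trans (add_le_add_left
      (le_csSup ⟨1, ?_⟩ (Set.mem_image_of_mem (Val v γ) (show _ ∧ _ from ⟨hσ', hP'⟩))) c)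
    rintro _ ⟨τ, hτ, rfl⟩
    exact Val_le_one hv hγ hτ.1

/-- If a ball of radius at least `2` lies in every `Popt u a`, every mechanism is persuasive. -/
lemma Pers_of_two_le {u : Ω → A → ℝ} {D : ℝ} (hD : 2 ≤ D) {η : A → Ω → ℝ}
    (hη : ∀ a, IsDist (η a)) (hball : ∀ a, ball1 (η a) D ⊆ Popt u a) {ν : Ω → ℝ}
    (hν : IsDist ν) {σ : Ω → A → ℝ} (hσ : IsMech σ) : Pers u ν σ := by
  intro a a'
  have hz : ∀ ω, 0 ≤ ν ω * σ ω a := fun ω => mul_nonneg (hν.1 ω) ((hσ ω).1 a)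
  exact sum_mul_sub_nonneg_of_near (hball a) hz ((sum_abs_sub_mass_mul_le (hη a) hz).trans
    (mul_le_mul_of_nonneg_right hD (Finset.sum_nonneg fun i _ => hz i))) a'

/-- Mixing an obedient joint distribution `X` with mass `t` near `η` keeps it obedient after a
relative perturbation `w` of the prior by at most `m`. -/
lemma sum_perturbed_nonneg {u : Ω → A → ℝ} {a : A} {η : Ω → ℝ} {D : ℝ} (hD : 0 ≤ D)
    (hη : IsDist η) (hball : ball1 η D ⊆ Popt u a) {X w : Ω → ℝ} {m s t : ℝ}
    (hX : ∀ ω, 0 ≤ X ω) (hs : 0 ≤ s) (hs1 : s ≤ 1) (ht : 0 ≤ t) (hm : m ≤ 1)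
    (hw : ∀ ω, 1 - m ≤ w ω) (hw' : ∀ ω, w ω ≤ 1 + m) (hm0 : 0 ≤ m)
    (hbound : 4 * m + 2 * m * t ≤ D * (t * (1 - m))) (a' : A)
    (hobey : 0 ≤ ∑ ω, X ω * (u ω a - u ω a')) :
    0 ≤ ∑ ω, w ω * (s * X ω + t * (∑ i, X i) * η ω) * (u ω a - u ω a') := by
  set q := ∑ i, X i with hq
  have hq0 : 0 ≤ q := Finset.sum_nonneg fun i _ => hX i
  set y : Ω → ℝ := fun ω => s * (w ω - (1 - m)) * X ω with hy
  set W := ∑ i, w i * η i with hW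
  have hy0 : ∀ ω, 0 ≤ y ω := fun ω =>
    mul_nonneg (mul_nonneg hs (sub_nonneg.2 (hw ω))) (hX ω)
  have hysum : ∑ i, y i ≤ 2 * m * q := by
    rw [hq, Finset.mul_sum]
    refine Finset.sum_le_sum fun ω _ => mul_le_mul_of_nonneg_right ?_ (hX ω)
    have := hw' ω
    have := hw ω
    nlinarith
  have hysum0 : 0 ≤ ∑ i, y i := Finset.sum_nonneg fun i _ => hy0 i
  have hWlo : 1 - m ≤ W := by
    calc 1 - m = ∑ i, (1 - m) * η i := by rw [← Finset.mul_sum, hη.2, mul_one]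
      _ ≤ W := Finset.sum_le_sum fun i _ => mul_le_mul_of_nonneg_right (hw i) (hη.1 i)
  have hWhi : W ≤ 1 + m := by
    calc W ≤ ∑ i, (1 + m) * η i :=
          Finset.sum_le_sum fun i _ => mul_le_mul_of_nonneg_right (hw' i) (hη.1 i)
      _ = 1 + m := by rw [← Finset.mul_sum, hη.2, mul_one]
  have htq : 0 ≤ t * q := mul_nonneg ht hq0
  have hmass : ∑ i, (y i + t * q * (w i * η i)) = ∑ i, y i + t * q * W := by
    rw [Finset.sum_add_distrib, ← Finset.mul_sum]
  have hz : 0 ≤ ∑ ω, (y ω + t * q * (w ω * η ω)) * (u ω a - u ω a') := by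
    refine sum_mul_sub_nonneg_of_near hball (fun ω => add_nonneg (hy0 ω)
      (mul_nonneg htq (mul_nonneg (by linarith [hw ω]) (hη.1 ω)))) ?_ a'
    rw [hmass]
    calc ∑ ω, |y ω + t * q * (w ω * η ω) - (∑ i, y i + t * q * W) * η ω|
        ≤ ∑ ω, (|y ω - (∑ i, y i) * η ω| + t * q * (2 * m) * η ω) := by
          refine Finset.sum_le_sum fun ω _ => ?_
          have hsplit : y ω + t * q * (w ω * η ω) - (∑ i, y i + t * q * W) * η ω
              = (y ω - (∑ i, y i) * η ω) + t * q * (w ω - W) * η ω := by ring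
          rw [hsplit]
          refine (abs_add_le _ _).trans (add_le_add_right ?_ _)
          rw [abs_mul, abs_mul, abs_of_nonneg htq, abs_of_nonneg (hη.1 ω)]
          refine mul_le_mul_of_nonneg_right (mul_le_mul_of_nonneg_left ?_ htq) (hη.1 ω)
          rw [abs_le]
          constructor <;> linarith [hw ω, hw' ω]
      _ ≤ 2 * (∑ i, y i) + t * q * (2 * m) := by
          rw [Finset.sum_add_distrib, ← Finset.mul_sum, hη.2, mul_one]
          exact add_le_add_left (sum_abs_sub_mass_mul_le hη hy0) _
      _ ≤ q * (4 * m + 2 * m * t) := by linarith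
      _ ≤ q * (D * (t * (1 - m))) := mul_le_mul_of_nonneg_left hbound hq0
      _ = D * (t * q * (1 - m)) := by ring
      _ ≤ D * (∑ i, y i + t * q * W) := by
          refine mul_le_mul_of_nonneg_left ?_ hD
          linarith [mul_le_mul_of_nonneg_left hWlo htq]
  have hsplit : ∑ ω, w ω * (s * X ω + t * q * η ω) * (u ω a - u ω a')
      = s * (1 - m) * (∑ ω, X ω * (u ω a - u ω a'))
        + ∑ ω, (y ω + t * q * (w ω * η ω)) * (u ω a - u ω a') := by
    rw [Finset.mul_sum (f := fun ω => X ω * (u ω a - u ω a')), ← Finset.sum_add_distrib]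
    refine Finset.sum_congr rfl fun ω _ => ?_
    simp only [hy]
    ring
  rw [hsplit]
  exact add_nonneg (mul_nonneg (mul_nonneg hs (by linarith)) hobey) hz

open Classical in
/-- The robustification of `σ`: scale `σ` by `1 - c`, add mass `t` times the signal weight at
`η a`, and reveal the remaining mass, recommending `best ω` in state `ω`. -/
noncomputable def robustify (γ : Ω → ℝ) (η : A → Ω → ℝ) (best : Ω → A) (c t : ℝ)
    (σ : Ω → A → ℝ) (ω : Ω) (a : A) : ℝ :=
  ((1 - c) * (γ ω * σ ω a) + t * (∑ i, γ i * σ i a) * η a ω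
    + if best ω = a then c * γ ω - t * ∑ b, (∑ i, γ i * σ i b) * η b ω else 0) / γ ω

lemma sum_weight_mul_nonneg {γ : Ω → ℝ} (hγ : IsDist γ) {σ : Ω → A → ℝ} (hσ : IsMech σ) (a : A) :
    0 ≤ ∑ i, γ i * σ i a :=
  Finset.sum_nonneg fun i _ => mul_nonneg (hγ.1 i) ((hσ i).1 a)

lemma mixture_le_one {γ : Ω → ℝ} (hγ : IsDist γ) {σ : Ω → A → ℝ} (hσ : IsMech σ)
    {η : A → Ω → ℝ} (hη : ∀ a, IsDist (η a)) (ω : Ω) :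
    ∑ b, (∑ i, γ i * σ i b) * η b ω ≤ 1 := by
  calc ∑ b, (∑ i, γ i * σ i b) * η b ω ≤ ∑ b, ∑ i, γ i * σ i b := by
        refine Finset.sum_le_sum fun b _ =>
          mul_le_of_le_one_right (sum_weight_mul_nonneg hγ hσ b) ?_
        rw [← (hη b).2]
        exact Finset.single_le_sum (fun i _ => (hη b).1 i) (Finset.mem_univ ω)
    _ = 1 := by
        rw [Finset.sum_comm]
        simp only [← Finset.mul_sum, (hσ _).2, mul_one]
        exact hγ.2

section Robustify

variable {γ : Ω → ℝ} {η : A → Ω → ℝ} {best : Ω → A} {c t : ℝ} {σ : Ω → A → ℝ}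

lemma residual_nonneg (hγ : IsDist γ) (hσ : IsMech σ) (hη : ∀ a, IsDist (η a)) (ht : 0 ≤ t)
    (htc : ∀ ω, t ≤ c * γ ω) (ω : Ω) :
    0 ≤ c * γ ω - t * ∑ b, (∑ i, γ i * σ i b) * η b ω :=
  sub_nonneg.2 ((mul_le_of_le_one_right ht (mixture_le_one hγ hσ hη ω)).trans (htc ω))

open Classical in
lemma IsMech_robustify (hγ : IsDist γ) (hγ0 : ∀ ω, 0 < γ ω) (hσ : IsMech σ)
    (hη : ∀ a, IsDist (η a)) (hc : c ≤ 1) (ht : 0 ≤ t) (htc : ∀ ω, t ≤ c * γ ω) :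
    IsMech (robustify γ η best c t σ) := by
  intro ω
  constructor
  · intro a
    refine div_nonneg (add_nonneg (add_nonneg ?_ ?_) ?_) (hγ.1 ω)
    · exact mul_nonneg (sub_nonneg.2 hc) (mul_nonneg (hγ.1 ω) ((hσ ω).1 a))
    · exact mul_nonneg (mul_nonneg ht (sum_weight_mul_nonneg hγ hσ a)) ((hη a).1 ω)
    · split_ifs
      · exact residual_nonneg hγ hσ hη ht htc ω
      · exact le_rfl
  · simp only [robustify]
    rw [← Finset.sum_div, div_eq_one_iff_eq (hγ0 ω).ne', Finset.sum_add_distrib,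
      Finset.sum_add_distrib, Fintype.sum_ite_eq]
    simp only [mul_assoc, ← Finset.mul_sum, (hσ ω).2]
    ring

lemma le_Val_robustify {v : Ω → A → ℝ} (hv : ∀ ω a, v ω a ∈ Set.Icc (0 : ℝ) 1)
    (hγ : IsDist γ) (hγ0 : ∀ ω, 0 < γ ω) (hσ : IsMech σ)
    (hη : ∀ a, IsDist (η a)) (ht : 0 ≤ t) (htc : ∀ ω, t ≤ c * γ ω) :
    (1 - c) * Val v γ σ ≤ Val v γ (robustify γ η best c t σ) := by
  simp only [Val, Finset.mul_sum]
  refine Finset.sum_le_sum fun ω _ => Finset.sum_le_sum fun a _ => ?_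
  rw [← mul_assoc]
  refine mul_le_mul_of_nonneg_right ?_ (hv ω a).1
  rw [robustify, mul_div_cancel₀ _ (hγ0 ω).ne', add_assoc]
  refine le_add_of_nonneg_right (add_nonneg ?_ ?_)
  · exact mul_nonneg (mul_nonneg ht (sum_weight_mul_nonneg hγ hσ a)) ((hη a).1 ω)
  · split_ifs
    · exact residual_nonneg hγ hσ hη ht htc ω
    · exact le_rfl

open Classical in
lemma Pers_robustify {u : Ω → A → ℝ} {D : ℝ} (hD : 0 ≤ D)
    (hγ : IsDist γ) (hγ0 : ∀ ω, 0 < γ ω) (hσ : IsMech σ) (hP : Pers u γ σ)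
    (hη : ∀ a, IsDist (η a)) (hball : ∀ a, ball1 (η a) D ⊆ Popt u a)
    (hbest : ∀ ω a, u ω a ≤ u ω (best ω))
    (hc0 : 0 ≤ c) (hc : c ≤ 1) (ht : 0 ≤ t) (htc : ∀ ω, t ≤ c * γ ω)
    {m : ℝ} (hm0 : 0 ≤ m) (hm : m ≤ 1) (hbound : 4 * m + 2 * m * t ≤ D * (t * (1 - m)))
    {ν : Ω → ℝ} (hνγ : ∀ ω, |ν ω - γ ω| ≤ m * γ ω) :
    Pers u ν (robustify γ η best c t σ) := by
  intro a a'
  have hw : ∀ ω, 1 - m ≤ ν ω / γ ω := fun ω => by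
    rw [le_div_iff₀ (hγ0 ω)]
    linarith [(abs_le.1 (hνγ ω)).1]
  have hw' : ∀ ω, ν ω / γ ω ≤ 1 + m := fun ω => by
    rw [div_le_iff₀ (hγ0 ω)]
    linarith [(abs_le.1 (hνγ ω)).2]
  have hmain := sum_perturbed_nonneg hD (hη a) (hball a)
    (fun ω => mul_nonneg (hγ.1 ω) ((hσ ω).1 a)) (sub_nonneg.2 hc) (sub_le_self 1 hc0) ht hm
    hw hw' hm0 hbound a' (hP a a')
  refine hmain.trans (Finset.sum_le_sum fun ω _ => ?_)
  have hsplit : ν ω * robustify γ η best c t σ ω a * (u ω a - u ω a')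
      = ν ω / γ ω * ((1 - c) * (γ ω * σ ω a) + t * (∑ i, γ i * σ i a) * η a ω)
          * (u ω a - u ω a')
        + ν ω / γ ω * ((if best ω = a then c * γ ω - t * ∑ b, (∑ i, γ i * σ i b) * η b ω else 0)
          * (u ω a - u ω a')) := by
    rw [robustify]
    ring
  rw [hsplit]
  refine le_add_of_nonneg_right (mul_nonneg (by linarith [hw ω]) ?_)
  split_ifs with h
  · exact mul_nonneg (residual_nonneg hγ hσ hη ht htc ω) (sub_nonneg.2 (h ▸ hbest ω a'))
  · rw [zero_mul]

end Robustify

end Persuasion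

/-- Gap bound at an approximate prior: under the regularity condition with constant `D`,
if `min_ω μ(ω) ≥ p0` and `‖γ − μ‖₁ ≤ ε`, then `GAP(γ, B₁(γ, ε)) ≤ (16/(p0² D))·ε`. -/
theorem stmt9 {Ω A : Type*} [Fintype Ω] [Fintype A]
    (hΩ : 2 ≤ Fintype.card Ω) (hA : 2 ≤ Fintype.card A)
    (u : Ω → A → ℝ) (v : Ω → A → ℝ) (hv : ∀ ω a, v ω a ∈ Set.Icc (0 : ℝ) 1)
    (D : ℝ) (hD : 0 < D)
    (hreg : ∀ a : A, ∃ η : Ω → ℝ, η ∈ Popt u a ∧ ball1 η D ⊆ Popt u a)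
    (p0 : ℝ) (hp0 : 0 < p0)
    (μ : Ω → ℝ) (hμ : IsDist μ) (hμp : ∀ ω, p0 ≤ μ ω)
    (ε : ℝ) (hε : 0 ≤ ε)
    (γ : Ω → ℝ) (hγ : IsDist γ) (hγμ : dist1 γ μ ≤ ε) :
    GAP u v γ (ball1 γ ε) ≤ (16 / (p0 ^ 2 * D)) * ε := by
  have hγ_lower : ∀ ω, p0 - ε ≤ γ ω := fun ω => by
    linarith [hμp ω, (abs_le.1 (abs_sub_le_of_dist1_le hγμ ω)).1]
  have hden : 0 < p0 ^ 2 * D := by positivity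
  set c := 16 / (p0 ^ 2 * D) * ε with hc
  have hc0 : 0 ≤ c := by positivity
  choose η hηP hball using hreg
  have hη : ∀ a, IsDist (η a) := fun a => (hηP a).1
  refine GAP_le_of_forall_exists hv hγ hc0 fun σ hσ hP => ?_
  rcases le_or_gt 1 c with h1 | h1
  · exact Or.inl h1
  refine Or.inr ?_
  rcases le_or_gt 2 D with hD2 | hD2
  · exact ⟨σ, hσ, fun ν hν => Pers_of_two_le hD2 hη hball hν.1 hσ, by linarith⟩
  have : Nonempty A := Fintype.card_pos_iff.1 (by omega)
  have : Nonempty Ω := Fintype.card_pos_iff.1 (by omega)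
  have hp1 : p0 ≤ 1 := by
    obtain ⟨ω⟩ := ‹Nonempty Ω›
    refine (hμp ω).trans ?_
    rw [← hμ.2]
    exact Finset.single_le_sum (fun i _ => hμ.1 i) (Finset.mem_univ ω)
  have hcε : p0 ^ 2 * D * c = 16 * ε := by
    rw [hc]
    field_simp
  have hεp : ε ≤ p0 / 8 := by
    have hlt : 16 * ε ≤ p0 ^ 2 * D := hcε ▸ mul_le_of_le_one_right hden.le h1.le
    nlinarith [mul_le_mul_of_nonneg_left hD2.le (sq_nonneg p0),
      mul_le_mul_of_nonneg_left hp1 hp0.le]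
  have hγ34 : ∀ ω, 3 / 4 * p0 ≤ γ ω := fun ω => by linarith [hγ_lower ω]
  have hγ0 : ∀ ω, 0 < γ ω := fun ω => lt_of_lt_of_le (by positivity) (hγ34 ω)
  choose best hbest using fun ω => Finite.exists_max (u ω)
  set t := 3 / 4 * p0 * c with ht
  set m := 4 * ε / (3 * p0) with hm
  have ht0 : 0 ≤ t := by positivity
  have hm0 : 0 ≤ m := by positivity
  have hm6 : m ≤ 1 / 6 := by
    rw [hm, div_le_iff₀ (by positivity)]
    linarith
  have ht1 : t ≤ 3 / 4 := by
    have := mul_le_mul hp1 h1.le hc0 zero_le_one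
    linarith
  have hmp : m * (3 / 4 * p0) = ε := by
    rw [hm]
    field_simp
  have htD : D * t = 9 * m := by
    rw [ht, hc, hm]
    field_simp
    ring
  have htc : ∀ ω, t ≤ c * γ ω := fun ω => by
    rw [ht, mul_comm]
    exact mul_le_mul_of_nonneg_left (hγ34 ω) hc0
  refine ⟨robustify γ η best c t σ, IsMech_robustify hγ hγ0 hσ hη h1.le ht0 htc,
    fun ν hν => ?_, ?_⟩
  · refine Pers_robustify hD.le hγ hγ0 hσ hP hη hball hbest hc0 h1.le ht0 htc hm0
      (by linarith) ?_ fun ω => (abs_sub_le_of_dist1_le hν.2 ω).trans ?_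
    · have hbd : D * (t * (1 - m)) = 9 * m * (1 - m) := by rw [← mul_assoc, htD]
      rw [hbd]
      nlinarith [mul_le_mul_of_nonneg_left ht1 hm0, mul_le_mul_of_nonneg_left hm6 hm0]
    · rw [← hmp]
      exact mul_le_mul_of_nonneg_left (hγ34 ω) hm0
  · have h := le_Val_robustify (best := best) hv hγ hγ0 hσ hη ht0 htc
    nlinarith [Val_le_one hv hγ hσ]
end

section
/- Concentration of the empirical distribution in ℓ1 norm (Lemma B.1): let Ω be a finite set, μ ∈ Δ(Ω), t ≥ 1, and let γ_t be the empirical distribution of t i.i.d. samples from μ. Then for every Φ with 0 < Φ ≤ 2√t: (i) if √(|Ω|/t)·(1 + Φ) ≤ 2, then P(‖γ_t − μ‖₁ ≥ √(|Ω|/t)·(1 + Φ)) ≤ exp(−3·Φ²·√|Ω|/56); and (ii) if √(|Ω|/t)·(1 + Φ) > 2, then P(‖γ_t − μ‖₁ ≥ √(|Ω|/t)·(1 + Φ)) = 0. -/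
/-- The empirical distribution of the first `t` of the samples `x`. -/
noncomputable def emp {Ω : Type*} [Fintype Ω] [DecidableEq Ω] {T : ℕ}
    (x : Fin T → Ω) (t : ℕ) : Ω → ℝ :=
  fun ω => ((Finset.univ.filter fun τ : Fin T => τ.1 < t ∧ x τ = ω).card : ℝ) / t

open Finset in
/-- A symmetrised form of Hoeffding's lemma on a finite set. -/
theorem IsDist.sum_mul_exp_le {Ω : Type*} [Fintype Ω] {μ : Ω → ℝ} (hμ : IsDist μ)
    (h : Ω → ℝ) (c : ℝ) (hc : ∀ a b, |h a - h b| ≤ c) :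
    ∑ a, μ a * Real.exp (h a) ≤ Real.exp (∑ a, μ a * h a + c ^ 2 / 2) := by
  obtain ⟨hμ0, hμ1⟩ := hμ
  have jensen : Real.exp (-∑ a, μ a * h a) ≤ ∑ b, μ b * Real.exp (-h b) := by
    have := convexOn_exp.map_sum_le (t := univ) (w := μ) (p := fun b => -h b)
      (fun i _ => hμ0 i) hμ1 (fun i _ => Set.mem_univ _)
    simpa [smul_eq_mul, Finset.sum_neg_distrib] using this
  have hA : 0 ≤ ∑ a, μ a * Real.exp (h a) :=
    sum_nonneg fun a _ => mul_nonneg (hμ0 a) (Real.exp_pos _).le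
  have hprod : (∑ a, μ a * Real.exp (h a)) * ∑ b, μ b * Real.exp (-h b)
      = ∑ a, ∑ b, μ a * μ b * Real.exp (h a - h b) := by
    rw [sum_mul_sum]
    refine sum_congr rfl fun a _ => sum_congr rfl fun b _ => ?_
    rw [sub_eq_add_neg, Real.exp_add]; ring
  have hsymm : ∑ a, ∑ b, μ a * μ b * Real.exp (h a - h b)
      = ∑ a, ∑ b, μ a * μ b * Real.cosh (h a - h b) := by
    have hcomm : ∑ a, ∑ b, μ a * μ b * Real.exp (h a - h b)
        = ∑ a, ∑ b, μ a * μ b * Real.exp (-(h a - h b)) := by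
      rw [sum_comm]
      refine sum_congr rfl fun a _ => sum_congr rfl fun b _ => ?_
      rw [neg_sub]; ring
    have hcosh : ∑ a, ∑ b, μ a * μ b * Real.cosh (h a - h b)
        = (∑ a, ∑ b, μ a * μ b * Real.exp (h a - h b)
          + ∑ a, ∑ b, μ a * μ b * Real.exp (-(h a - h b))) / 2 := by
      simp only [← sum_add_distrib, sum_div]
      refine sum_congr rfl fun a _ => sum_congr rfl fun b _ => ?_
      rw [Real.cosh_eq]; ring
    rw [hcosh, ← hcomm]; ring
  have hbound : ∑ a, ∑ b, μ a * μ b * Real.cosh (h a - h b) ≤ Real.exp (c ^ 2 / 2) := by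
    calc ∑ a, ∑ b, μ a * μ b * Real.cosh (h a - h b)
        ≤ ∑ a, ∑ b, μ a * μ b * Real.exp (c ^ 2 / 2) := by
          refine sum_le_sum fun a _ => sum_le_sum fun b _ => ?_
          refine mul_le_mul_of_nonneg_left ?_ (mul_nonneg (hμ0 a) (hμ0 b))
          refine (Real.cosh_le_exp_half_sq _).trans (Real.exp_le_exp.2 ?_)
          have := sq_le_sq' (abs_le.1 (hc a b)).1 (abs_le.1 (hc a b)).2
          linarith
      _ = Real.exp (c ^ 2 / 2) := by
          simp only [← sum_mul, ← mul_sum, hμ1, mul_one, one_mul]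
  have hmain := (mul_le_mul_of_nonneg_left jensen hA).trans
    ((hprod.trans hsymm).le.trans hbound)
  rw [Real.exp_neg, ← div_eq_mul_inv, div_le_iff₀ (Real.exp_pos _), ← Real.exp_add] at hmain
  rwa [add_comm]

open Finset in
theorem prodExp_succ {Ω : Type*} [Fintype Ω] {T : ℕ} (μ : Ω → ℝ) (f : (Fin (T + 1) → Ω) → ℝ) :
    prodExp μ f = ∑ a, μ a * prodExp μ fun y : Fin T → Ω => f (Fin.cons a y) := by
  unfold prodExp
  rw [← (Fin.consEquiv fun _ : Fin (T + 1) => Ω).sum_comp, Fintype.sum_prod_type]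
  refine sum_congr rfl fun a _ => ?_
  rw [mul_sum]
  refine sum_congr rfl fun y _ => ?_
  simp [Fin.consEquiv, Fin.prod_univ_succ, mul_assoc]

theorem prodExp_zero {Ω : Type*} [Fintype Ω] (μ : Ω → ℝ) (f : (Fin 0 → Ω) → ℝ) :
    prodExp μ f = f Fin.elim0 := by
  simp [prodExp, Subsingleton.elim (default : Fin 0 → Ω) Fin.elim0]

theorem prodExp_add {Ω : Type*} [Fintype Ω] {T : ℕ} (μ : Ω → ℝ) (f g : (Fin T → Ω) → ℝ) :
    prodExp μ (fun x => f x + g x) = prodExp μ f + prodExp μ g := by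
  simp [prodExp, mul_add, Finset.sum_add_distrib]

theorem prodExp_const_mul {Ω : Type*} [Fintype Ω] {T : ℕ} (μ : Ω → ℝ) (k : ℝ)
    (f : (Fin T → Ω) → ℝ) : prodExp μ (fun x => k * f x) = k * prodExp μ f := by
  simp only [prodExp, Finset.mul_sum]
  exact Finset.sum_congr rfl fun x _ => by ring

theorem prodExp_sum {Ω ι : Type*} [Fintype Ω] {T : ℕ} (μ : Ω → ℝ) (s : Finset ι)
    (f : ι → (Fin T → Ω) → ℝ) :
    prodExp μ (fun x => ∑ i ∈ s, f i x) = ∑ i ∈ s, prodExp μ (f i) := by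
  simp only [prodExp, Finset.mul_sum]
  exact Finset.sum_comm

theorem IsDist.prodExp_const {Ω : Type*} [Fintype Ω] {T : ℕ} {μ : Ω → ℝ} (hμ : IsDist μ) (k : ℝ) :
    prodExp μ (fun _ : Fin T → Ω => k) = k := by
  induction T with
  | zero => exact prodExp_zero _ _
  | succ T ih => rw [prodExp_succ]; simp only [ih, ← Finset.sum_mul, hμ.2, one_mul]

theorem IsDist.prodExp_mono {Ω : Type*} [Fintype Ω] {T : ℕ} {μ : Ω → ℝ} (hμ : IsDist μ)
    {f g : (Fin T → Ω) → ℝ} (h : ∀ x, f x ≤ g x) : prodExp μ f ≤ prodExp μ g :=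
  Finset.sum_le_sum fun x _ =>
    mul_le_mul_of_nonneg_left (h x) (Finset.prod_nonneg fun _ _ => hμ.1 _)

/-- A bound on the exponential moments of a function with bounded differences. -/
theorem IsDist.prodExp_exp_le {Ω : Type*} [Fintype Ω] {T : ℕ} {μ : Ω → ℝ} (hμ : IsDist μ)
    (c : ℝ) (g : (Fin T → Ω) → ℝ)
    (hg : ∀ i x y, (∀ j, j ≠ i → x j = y j) → |g x - g y| ≤ c) :
    prodExp μ (fun x => Real.exp (g x)) ≤ Real.exp (prodExp μ g + T * (c ^ 2 / 2)) := by
  induction T with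
  | zero => simp [prodExp_zero]
  | succ T ih =>
    rw [prodExp_succ, prodExp_succ μ g]
    set h : Ω → ℝ := fun a => prodExp μ fun y : Fin T → Ω => g (Fin.cons a y) with hh
    have h1 : ∀ a, prodExp μ (fun y : Fin T → Ω => Real.exp (g (Fin.cons a y)))
        ≤ Real.exp (h a) * Real.exp (T * (c ^ 2 / 2)) := by
      intro a
      rw [← Real.exp_add]
      refine ih _ fun i x y hxy => hg i.succ _ _ fun j => ?_
      refine Fin.cases (fun _ => by simp) (fun j hj => ?_) j
      simpa using hxy j fun e => hj (e ▸ rfl)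
    have hle : ∀ a b, h a ≤ h b + c := by
      intro a b
      calc h a ≤ prodExp μ fun y : Fin T → Ω => g (Fin.cons b y) + c := by
            refine hμ.prodExp_mono fun y => ?_
            have := (abs_le.1 (hg 0 (Fin.cons a y) (Fin.cons b y) fun j => by
              refine Fin.cases (fun hj => absurd rfl hj) (fun j _ => by simp) j)).2
            linarith
        _ = h b + c := by rw [prodExp_add, hμ.prodExp_const]
    have h2 := hμ.sum_mul_exp_le h c fun a b =>
      abs_le.2 ⟨by linarith [hle b a], by linarith [hle a b]⟩
    calc ∑ a, μ a * prodExp μ (fun y : Fin T → Ω => Real.exp (g (Fin.cons a y)))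
        ≤ ∑ a, μ a * (Real.exp (h a) * Real.exp (T * (c ^ 2 / 2))) :=
          Finset.sum_le_sum fun a _ => mul_le_mul_of_nonneg_left (h1 a) (hμ.1 a)
      _ = (∑ a, μ a * Real.exp (h a)) * Real.exp (T * (c ^ 2 / 2)) := by
          rw [Finset.sum_mul]; exact Finset.sum_congr rfl fun a _ => by ring
      _ ≤ Real.exp (∑ a, μ a * h a + c ^ 2 / 2) * Real.exp (T * (c ^ 2 / 2)) :=
          mul_le_mul_of_nonneg_right h2 (Real.exp_pos _).le
      _ = Real.exp (∑ a, μ a * h a + (T + 1 : ℕ) * (c ^ 2 / 2)) := by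
          rw [← Real.exp_add]; push_cast; ring_nf

/-- The second moment of a sum of centred i.i.d. random variables. -/
theorem IsDist.prodExp_sum_sq {Ω : Type*} [Fintype Ω] {T : ℕ} {μ : Ω → ℝ} (hμ : IsDist μ)
    (φ : Ω → ℝ) (hφ : ∑ a, μ a * φ a = 0) :
    prodExp μ (fun x : Fin T → Ω => (∑ i, φ (x i)) ^ 2) = T * ∑ a, μ a * φ a ^ 2 := by
  induction T with
  | zero => simp [prodExp_zero]
  | succ T ih =>
    rw [prodExp_succ]
    have h : ∀ a, prodExp μ (fun y : Fin T → Ω =>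
          (∑ i, φ ((Fin.cons a y : Fin (T + 1) → Ω) i)) ^ 2)
        = φ a ^ 2 + (2 * φ a * prodExp μ (fun y : Fin T → Ω => ∑ i, φ (y i))
          + T * ∑ a, μ a * φ a ^ 2) := by
      intro a
      rw [← ih, ← prodExp_const_mul, ← prodExp_add, ← hμ.prodExp_const (T := T) (φ a ^ 2),
        ← prodExp_add]
      congr 1
      funext y
      rw [Fin.sum_univ_succ]
      simp only [Fin.cons_zero, Fin.cons_succ]
      ring
    simp only [h, mul_add, Finset.sum_add_distrib, ← Finset.sum_mul, hμ.2]
    have h0 : ∀ E : ℝ, ∑ a, μ a * (2 * φ a * E) = 0 := fun E => by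
      rw [← zero_mul (2 * E), ← hφ, Finset.sum_mul]
      exact Finset.sum_congr rfl fun a _ => by ring
    rw [h0]; push_cast; ring

theorem emp_eq_sum {Ω : Type*} [Fintype Ω] [DecidableEq Ω] {t : ℕ} (x : Fin t → Ω) (ω : Ω) :
    emp x t ω = (∑ τ, if x τ = ω then (1 : ℝ) else 0) / t := by
  simp [emp, Finset.sum_boole]

theorem emp_nonneg {Ω : Type*} [Fintype Ω] [DecidableEq Ω] {T : ℕ} (x : Fin T → Ω) (t : ℕ)
    (ω : Ω) : 0 ≤ emp x t ω := by
  unfold emp; positivity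

theorem sum_emp {Ω : Type*} [Fintype Ω] [DecidableEq Ω] {t : ℕ} (ht : 1 ≤ t) (x : Fin t → Ω) :
    ∑ ω, emp x t ω = 1 := by
  have : (t : ℝ) ≠ 0 := by positivity
  simp only [emp_eq_sum, ← Finset.sum_div]
  rw [Finset.sum_comm]
  simp [this]

theorem dist1_emp_le_two {Ω : Type*} [Fintype Ω] [DecidableEq Ω] {μ : Ω → ℝ} (hμ : IsDist μ)
    {t : ℕ} (ht : 1 ≤ t) (x : Fin t → Ω) : dist1 (emp x t) μ ≤ 2 := by
  calc dist1 (emp x t) μ ≤ ∑ ω, (emp x t ω + μ ω) :=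
        Finset.sum_le_sum fun ω _ => abs_le.2
          ⟨by linarith [emp_nonneg x t ω], by linarith [hμ.1 ω]⟩
    _ = 2 := by rw [Finset.sum_add_distrib, sum_emp ht, hμ.2]; norm_num

theorem abs_dist1_emp_sub_le {Ω : Type*} [Fintype Ω] [DecidableEq Ω] (μ : Ω → ℝ)
    {t : ℕ} (i : Fin t) (x y : Fin t → Ω) (hxy : ∀ j, j ≠ i → x j = y j) :
    |dist1 (emp x t) μ - dist1 (emp y t) μ| ≤ 2 / t := by
  have hdiff : ∀ ω, emp x t ω - emp y t ω
      = ((if x i = ω then (1 : ℝ) else 0) - if y i = ω then (1 : ℝ) else 0) / t := by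
    intro ω
    rw [emp_eq_sum, emp_eq_sum, ← sub_div, ← Finset.sum_sub_distrib,
      Finset.sum_eq_single i (fun j _ hj => by rw [hxy j hj, sub_self]) (by simp)]
  calc |dist1 (emp x t) μ - dist1 (emp y t) μ|
      = |∑ ω, (|emp x t ω - μ ω| - |emp y t ω - μ ω|)| := by
        rw [Finset.sum_sub_distrib]; rfl
    _ ≤ ∑ ω, |emp x t ω - emp y t ω| := by
        refine (Finset.abs_sum_le_sum_abs _ _).trans (Finset.sum_le_sum fun ω _ => ?_)
        simpa using abs_abs_sub_abs_le (emp x t ω - μ ω) (emp y t ω - μ ω)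
    _ ≤ ∑ ω, ((if x i = ω then (1 : ℝ) else 0) + if y i = ω then (1 : ℝ) else 0) / t := by
        refine Finset.sum_le_sum fun ω _ => ?_
        rw [hdiff, abs_div, Nat.abs_cast]
        gcongr
        split_ifs <;> norm_num
    _ = 2 / t := by
        rw [← Finset.sum_div, Finset.sum_add_distrib]
        simp only [Finset.sum_ite_eq, Finset.mem_univ, if_true]
        norm_num

theorem IsDist.prodExp_emp_sub_sq_le {Ω : Type*} [Fintype Ω] [DecidableEq Ω] {μ : Ω → ℝ}
    (hμ : IsDist μ) {t : ℕ} (ht : 1 ≤ t) (ω : Ω) :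
    prodExp μ (fun x : Fin t → Ω => (emp x t ω - μ ω) ^ 2) ≤ μ ω / t := by
  have ht0 : (t : ℝ) ≠ 0 := by positivity
  set φ : Ω → ℝ := fun a => (if a = ω then (1 : ℝ) else 0) - μ ω with hφ
  have hmean : ∑ a, μ a * φ a = 0 := by
    simp [hφ, mul_sub, Finset.sum_sub_distrib, ← Finset.sum_mul, hμ.2]
  have hvar : ∑ a, μ a * φ a ^ 2 ≤ μ ω := by
    have : ∀ a, μ a * φ a ^ 2 = (if a = ω then μ a * (1 - 2 * μ ω) else 0) + μ a * μ ω ^ 2 := by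
      intro a
      simp only [hφ]
      split_ifs <;> ring
    simp only [this, Finset.sum_add_distrib, ← Finset.sum_mul, hμ.2, Finset.sum_ite_eq',
      Finset.mem_univ, if_true]
    nlinarith [sq_nonneg (μ ω)]
  have heq : (fun x : Fin t → Ω => (emp x t ω - μ ω) ^ 2)
      = fun x => (1 / (t : ℝ) ^ 2) * (∑ i, φ (x i)) ^ 2 := by
    funext x
    have : ∑ i, φ (x i) = t * (emp x t ω - μ ω) := by
      rw [emp_eq_sum, mul_sub, mul_div_cancel₀ _ ht0]
      simp [hφ, Finset.sum_sub_distrib]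
    rw [this]
    field_simp
  rw [heq, prodExp_const_mul, hμ.prodExp_sum_sq φ hmean]
  calc 1 / (t : ℝ) ^ 2 * (t * ∑ a, μ a * φ a ^ 2) = (∑ a, μ a * φ a ^ 2) / t := by field_simp
    _ ≤ μ ω / t := by gcongr

theorem IsDist.sq_prodExp_le {Ω : Type*} [Fintype Ω] {T : ℕ} {μ : Ω → ℝ} (hμ : IsDist μ)
    (f : (Fin T → Ω) → ℝ) : prodExp μ f ^ 2 ≤ prodExp μ fun x => f x ^ 2 := by
  have h := hμ.prodExp_mono (f := fun x => 2 * prodExp μ f * f x)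
    (g := fun x => f x ^ 2 + prodExp μ f ^ 2)
    fun x => by nlinarith [sq_nonneg (f x - prodExp μ f)]
  rw [prodExp_const_mul, prodExp_add, hμ.prodExp_const] at h
  nlinarith

/-- The expected ℓ1 deviation of the empirical distribution is at most `√(|Ω|/t)`. -/
theorem IsDist.prodExp_dist1_emp_le {Ω : Type*} [Fintype Ω] [DecidableEq Ω] {μ : Ω → ℝ}
    (hμ : IsDist μ) {t : ℕ} (ht : 1 ≤ t) :
    prodExp μ (fun x : Fin t → Ω => dist1 (emp x t) μ) ≤ Real.sqrt ((Fintype.card Ω : ℝ) / t) := by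
  refine Real.le_sqrt_of_sq_le ((hμ.sq_prodExp_le _).trans ?_)
  calc prodExp μ (fun x : Fin t → Ω => dist1 (emp x t) μ ^ 2)
      ≤ prodExp μ (fun x : Fin t → Ω => (Fintype.card Ω : ℝ) * ∑ ω, (emp x t ω - μ ω) ^ 2) := by
        refine hμ.prodExp_mono fun x => ?_
        have := sq_sum_le_card_mul_sum_sq (s := Finset.univ) (f := fun ω => |emp x t ω - μ ω|)
        simpa [dist1] using this
    _ = (Fintype.card Ω : ℝ) * ∑ ω, prodExp μ (fun x : Fin t → Ω => (emp x t ω - μ ω) ^ 2) := by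
        rw [prodExp_const_mul, prodExp_sum]
    _ ≤ (Fintype.card Ω : ℝ) * ∑ ω, μ ω / t := by
        gcongr with ω _
        exact hμ.prodExp_emp_sub_sq_le ht ω
    _ = (Fintype.card Ω : ℝ) / t := by rw [← Finset.sum_div, hμ.2]; ring

/-- The Chernoff bound for `prodProb`. -/
theorem IsDist.prodProb_le_prodExp_exp {Ω : Type*} [Fintype Ω] {T : ℕ} {μ : Ω → ℝ}
    (hμ : IsDist μ) (f : (Fin T → Ω) → ℝ) (r : ℝ) {l : ℝ} (hl : 0 ≤ l) :
    prodProb μ {x | r ≤ f x} ≤ prodExp μ fun x => Real.exp (l * (f x - r)) := by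
  refine Finset.sum_le_sum fun x _ => ?_
  have hp : 0 ≤ ∏ t, μ (x t) := Finset.prod_nonneg fun _ _ => hμ.1 _
  by_cases hx : r ≤ f x
  · rw [Set.indicator_of_mem (show x ∈ {x | r ≤ f x} from hx)]
    exact le_mul_of_one_le_right hp (Real.one_le_exp (mul_nonneg hl (sub_nonneg.2 hx)))
  · rw [Set.indicator_of_notMem (show x ∉ {x | r ≤ f x} from hx)]
    exact mul_nonneg hp (Real.exp_pos _).le

/-- Concentration of the ℓ1 deviation of the empirical distribution. -/
theorem IsDist.prodProb_dist1_emp_le {Ω : Type*} [Fintype Ω] [DecidableEq Ω] {μ : Ω → ℝ}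
    (hμ : IsDist μ) {t : ℕ} (ht : 1 ≤ t) {s : ℝ} (hs : 0 ≤ s) :
    prodProb μ {x : Fin t → Ω |
        Real.sqrt ((Fintype.card Ω : ℝ) / t) + s ≤ dist1 (emp x t) μ}
      ≤ Real.exp (-(s ^ 2 * t / 8)) := by
  have ht0 : (0 : ℝ) < t := by positivity
  set r := Real.sqrt ((Fintype.card Ω : ℝ) / t) + s with hr
  have hl : 0 ≤ s * t / 4 := by positivity
  refine (hμ.prodProb_le_prodExp_exp _ r hl).trans ?_
  refine (hμ.prodExp_exp_le (s * t / 4 * (2 / t)) _ fun i x y hxy => ?_).trans ?_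
  · rw [← mul_sub, sub_sub_sub_cancel_right, abs_mul, abs_of_nonneg hl]
    exact mul_le_mul_of_nonneg_left (abs_dist1_emp_sub_le μ i x y hxy) hl
  · rw [Real.exp_le_exp, prodExp_const_mul]
    simp only [sub_eq_add_neg]
    rw [prodExp_add, hμ.prodExp_const]
    have hm := hμ.prodExp_dist1_emp_le ht
    have h1 := mul_le_mul_of_nonneg_left
      (show prodExp μ (fun x : Fin t → Ω => dist1 (emp x t) μ) + -r ≤ -s by linarith) hl
    have h2 : (t : ℝ) * ((s * t / 4 * (2 / t)) ^ 2 / 2) = s ^ 2 * t / 8 := by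
      field_simp; ring
    rw [h2]
    linarith

/-- Concentration of the empirical distribution in ℓ1 norm (Lemma B.1): for `t` i.i.d.
samples from `μ` and `0 < Φ ≤ 2√t`, if `√(|Ω|/t)(1+Φ) ≤ 2` then
`P(‖γ_t − μ‖₁ ≥ √(|Ω|/t)(1+Φ)) ≤ exp(−3Φ²√|Ω|/56)`, and if `√(|Ω|/t)(1+Φ) > 2` this
probability is zero. -/
theorem stmt10 {Ω : Type*} [Fintype Ω] [DecidableEq Ω]
    (μ : Ω → ℝ) (hμ : IsDist μ) (t : ℕ) (ht : 1 ≤ t)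
    (Φ : ℝ) (hΦ : 0 < Φ) (hΦt : Φ ≤ 2 * Real.sqrt t) :
    (Real.sqrt ((Fintype.card Ω : ℝ) / t) * (1 + Φ) ≤ 2 →
      prodProb μ {x : Fin t → Ω |
          Real.sqrt ((Fintype.card Ω : ℝ) / t) * (1 + Φ) ≤ dist1 (emp x t) μ}
        ≤ Real.exp (-(3 * Φ ^ 2 * Real.sqrt (Fintype.card Ω)) / 56))
    ∧ (2 < Real.sqrt ((Fintype.card Ω : ℝ) / t) * (1 + Φ) →
      prodProb μ {x : Fin t → Ω |
          Real.sqrt ((Fintype.card Ω : ℝ) / t) * (1 + Φ) ≤ dist1 (emp x t) μ} = 0) := by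
  have ht0 : (0 : ℝ) < t := by positivity
  refine ⟨fun _ => ?_, fun h2 => ?_⟩
  · rw [show Real.sqrt ((Fintype.card Ω : ℝ) / t) * (1 + Φ)
      = Real.sqrt ((Fintype.card Ω : ℝ) / t) + Real.sqrt ((Fintype.card Ω : ℝ) / t) * Φ by ring]
    refine (hμ.prodProb_dist1_emp_le ht (by positivity)).trans (Real.exp_le_exp.2 ?_)
    have : Nonempty Ω := by
      by_contra hne
      rw [not_nonempty_iff] at hne
      simpa using hμ.2
    have hn : (1 : ℝ) ≤ Fintype.card Ω := by exact_mod_cast Fintype.card_pos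
    have hsqrt : Real.sqrt (Fintype.card Ω) ≤ Fintype.card Ω :=
      Real.sqrt_le_iff.2 ⟨by positivity, by nlinarith⟩
    have hsq : (Real.sqrt ((Fintype.card Ω : ℝ) / t) * Φ) ^ 2 * t = Fintype.card Ω * Φ ^ 2 := by
      rw [mul_pow, Real.sq_sqrt (by positivity)]
      field_simp
    rw [hsq]
    have h1 := mul_le_mul_of_nonneg_right hsqrt (sq_nonneg Φ)
    have h3 : 0 ≤ (Fintype.card Ω : ℝ) * Φ ^ 2 := by positivity
    linarith
  · refine Finset.sum_eq_zero fun x _ => Set.indicator_of_notMem (fun hx => ?_) _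
    exact absurd (h2.trans_le hx) (not_lt.2 (dist1_emp_le_two hμ ht x))
end
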